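/- arXiv:1307.3413 — 3 statements merged into one kernel-verified Lean document; each statement's English description precedes it below -/
import Mathlib

section
/- Let p ∈ 𝕊^M, t > 0 and let r ≥ 1 be an integer; set t' = t/r. There exist an intensity vector λ = (λ₂,…,λ_{M−1}) with λ_j > 0 for all j ∈ {2,…,M−1} and an index l ∈ {2,…,M} such that: (i) the row vector w = p·(N_{t'}(λ))^{r−1} (p viewed as a row vector, matrix power r−1) has w_j > 0 for every j ∈ {1,…,M}; (ii) setting q_j = w_j/∑_{k=1}^M w_k and x₀ = (∑_{j=1}^M κ_j q_j(1+t'λ_j k̃_j))/(∑_{j=1}^M q_j(1+t'λ_j k̃_j)) (with λ₁ = λ_M = 0), one has κ_{l−1} < x₀ ≤ κ_l; (iii) for 2 ≤ j ≤ l−1, λ_j = (1/(t'q_j))·((κ_{j+1}−κ_{j−1})/((κ_{j+1}−κ_j)(κ_j−κ_{j−1})))·∑_{a=1}^{j−1}(κ_j−κ_a)q_a(1+t'λ_a k̃_a); and (iv) for l ≤ j ≤ M−1, λ_j = (1/(t'q_j))·((κ_{j+1}−κ_{j−1})/((κ_{j+1}−κ_j)(κ_j−κ_{j−1})))·∑_{a=j+1}^{M}(κ_a−κ_j)q_a(1+t'λ_a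 k̃_a). That is, ((λ₁,…,λ_M), l) solves the G-system with time parameter t' and probability vector q, where q is the normalized (r−1)-fold push-forward of p under N_{t'}(λ). -/
noncomputable section

open Finset MeasureTheory

/-- Paper index `j ∈ {1,…,M+1}` as an element of `Fin (M+1)`. -/
def fid (M j : ℕ) : Fin (M + 1) := ⟨(j - 1) % (M + 1), Nat.mod_lt _ (Nat.succ_pos M)⟩

/-- `q_{j,j+1}` built from the grid `i` and the drift `b`. -/
def qup (i b : ℕ → ℝ) (j : ℕ) : ℝ :=
  ((i j - i (j - 1)) / (i (j + 1) - i (j - 1))) * (1 + (i (j + 1) - i j) * b j)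

/-- `q_{j,j-1}` built from the grid `i` and the drift `b`. -/
def qdn (i b : ℕ → ℝ) (j : ℕ) : ℝ :=
  ((i (j + 1) - i j) / (i (j + 1) - i (j - 1))) * (1 - (i j - i (j - 1)) * b j)

/-- `k̃_j = (i_{j+1}-i_j)(i_j-i_{j-1}) k_j` for `2 ≤ j ≤ M-1`, and `0` otherwise. -/
def ktil (M : ℕ) (i k : ℕ → ℝ) (j : ℕ) : ℝ :=
  if 2 ≤ j ∧ j ≤ M - 1 then (i (j + 1) - i j) * (i j - i (j - 1)) * k j else 0

/-- The drift hypothesis `-1/(i_{j+1}-i_j) < b_j < 1/(i_j - i_{j-1})`. -/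
def DriftHyp (M : ℕ) (i b : ℕ → ℝ) : Prop :=
  ∀ j, 2 ≤ j → j ≤ M - 1 →
    -(1 / (i (j + 1) - i j)) < b j ∧ b j < 1 / (i j - i (j - 1))

/-- An intensity vector: nonnegative on `{2,…,M-1}` and (by convention) `0` elsewhere. -/
def IntensityVec (M : ℕ) (lam : ℕ → ℝ) : Prop :=
  (∀ j, 2 ≤ j → j ≤ M - 1 → 0 ≤ lam j) ∧ (∀ j, ¬(2 ≤ j ∧ j ≤ M - 1) → lam j = 0)

/-- `p ∈ 𝕊^M`. -/
def ProbVec (M : ℕ) (p : ℕ → ℝ) : Prop :=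
  (∀ j, 1 ≤ j → j ≤ M → 0 < p j) ∧ ∑ j ∈ Finset.Icc 1 M, p j = 1

/-- `κ` are martingale coordinates for `(i,b)`. -/
def MartCoord (M : ℕ) (i b κ : ℕ → ℝ) : Prop :=
  (∀ j, 1 ≤ j → j ≤ M - 1 → κ j < κ (j + 1)) ∧
  (∀ j, 2 ≤ j → j ≤ M - 1 →
    qup i b j = (κ j - κ (j - 1)) / (κ (j + 1) - κ (j - 1)) ∧
    qdn i b j = (κ (j + 1) - κ j) / (κ (j + 1) - κ (j - 1)))

/-- The point `x₀` of the G-system. -/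
def Gx0 (M : ℕ) (s : ℝ) (κ kt P G : ℕ → ℝ) : ℝ :=
  (∑ j ∈ Finset.Icc 1 M, κ j * P j * (1 + s * G j * kt j)) /
    (∑ j ∈ Finset.Icc 1 M, P j * (1 + s * G j * kt j))

/-- `(G, l)` solves the G-system with time parameter `s` and probability vector `P`. -/
def GSystem (M : ℕ) (s : ℝ) (κ kt P G : ℕ → ℝ) (l : ℕ) : Prop :=
  2 ≤ l ∧ l ≤ M ∧
  (∀ j, 1 ≤ j → j ≤ M → 0 ≤ G j) ∧ G 1 = 0 ∧ G M = 0 ∧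
  κ (l - 1) < Gx0 M s κ kt P G ∧ Gx0 M s κ kt P G ≤ κ l ∧
  (∀ j, 2 ≤ j → j ≤ l - 1 →
    G j = (1 / (s * P j)) *
      ((κ (j + 1) - κ (j - 1)) / ((κ (j + 1) - κ j) * (κ j - κ (j - 1)))) *
      ∑ a ∈ Finset.Icc 1 (j - 1), (κ j - κ a) * P a * (1 + s * G a * kt a)) ∧
  (∀ j, l ≤ j → j ≤ M - 1 →
    G j = (1 / (s * P j)) *
      ((κ (j + 1) - κ (j - 1)) / ((κ (j + 1) - κ j) * (κ j - κ (j - 1)))) *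
      ∑ a ∈ Finset.Icc (j + 1) M, (κ a - κ j) * P a * (1 + s * G a * kt a))

/-- Entry `(j,c)` (paper indices in `{1,…,M+1}`) of the matrix `Ñ_t(λ)`. -/
def NtE (M : ℕ) (t : ℝ) (i b k lam : ℕ → ℝ) (j c : ℕ) : ℝ :=
  if 2 ≤ j ∧ j ≤ M - 1 then
    if c = j then 1 + t * lam j * (1 + ktil M i k j)
    else if c = j + 1 then -(t * lam j * qup i b j)
    else if c = j - 1 then -(t * lam j * qdn i b j)
    else if c = M + 1 then -(t * lam j * ktil M i k j)
    else 0
  else if c = j then 1 else 0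

/-- The `(M+1)×(M+1)` matrix `Ñ_t(λ)`. -/
def Ntilde (M : ℕ) (t : ℝ) (i b k lam : ℕ → ℝ) : Matrix (Fin (M + 1)) (Fin (M + 1)) ℝ :=
  Matrix.of fun u v => NtE M t i b k lam (u.1 + 1) (v.1 + 1)

/-- The top-left `M×M` block `N_t(λ)` of `Ñ_t(λ)`. -/
def NMat (M : ℕ) (t : ℝ) (i b k lam : ℕ → ℝ) : Matrix (Fin M) (Fin M) ℝ :=
  Matrix.of fun u v => NtE M t i b k lam (u.1 + 1) (v.1 + 1)

/-- Entry `(j,c)` (paper indices) of the one-step transition matrix `P̃^{(h)}(λ)`. -/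
def PtE (M : ℕ) (h : ℝ) (i b k lam : ℕ → ℝ) (j c : ℕ) : ℝ :=
  if 2 ≤ j ∧ j ≤ M - 1 then
    if c = j then 1 - h * lam j * (1 + ktil M i k j)
    else if c = j + 1 then h * lam j * qup i b j
    else if c = j - 1 then h * lam j * qdn i b j
    else if c = M + 1 then h * lam j * ktil M i k j
    else 0
  else if c = j then 1 else 0

/-- The `(M+1)×(M+1)` transition matrix `P̃^{(h)}(λ)`. -/
def Ptilde (M : ℕ) (h : ℝ) (i b k lam : ℕ → ℝ) : Matrix (Fin (M + 1)) (Fin (M + 1)) ℝ :=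
  Matrix.of fun u v => PtE M h i b k lam (u.1 + 1) (v.1 + 1)

/-- Entry `(j,c)` (paper indices) of the intensity matrix `Θ(λ)`. -/
def ThE (M : ℕ) (i b k lam : ℕ → ℝ) (j c : ℕ) : ℝ :=
  if 2 ≤ j ∧ j ≤ M - 1 then
    if c = j then -(lam j * (1 + ktil M i k j))
    else if c = j + 1 then lam j * qup i b j
    else if c = j - 1 then lam j * qdn i b j
    else if c = M + 1 then lam j * ktil M i k j
    else 0
  else 0

/-- The `(M+1)×(M+1)` intensity matrix `Θ(λ)`. -/
def Theta (M : ℕ) (i b k lam : ℕ → ℝ) : Matrix (Fin (M + 1)) (Fin (M + 1)) ℝ :=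
  Matrix.of fun u v => ThE M i b k lam (u.1 + 1) (v.1 + 1)


/-- The row vector `w = p · (N_{t'}(λ))^{r-1}` (push-forward of `p`, viewed as a row
vector, through the `(r-1)`-st power of the top-left block `N_{t'}(λ)`). -/
def wvec (M r : ℕ) (s : ℝ) (i b k lam p : ℕ → ℝ) (v : Fin M) : ℝ :=
  ∑ u : Fin M, p (u.1 + 1) * ((NMat M s i b k lam) ^ (r - 1)) u v

/-- The normalization `q` of `w`, written at paper indices `a ∈ {1,…,M}`. -/
def qnorm (M r : ℕ) (hM : 0 < M) (s : ℝ) (i b k lam p : ℕ → ℝ) (a : ℕ) : ℝ :=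
  wvec M r s i b k lam p ⟨(a - 1) % M, Nat.mod_lt _ hM⟩ /
    ∑ v : Fin M, wvec M r s i b k lam p v

/-- A finite set `σ` is dominant for the orders pulled back along the `ρ i` if no point lies
strictly above all the minima of `σ`. -/
def IsDominant {I V β : Type*} [LinearOrder β] (ρ : I → V → β) (σ : Finset V) : Prop :=
  ∀ y, ∃ i, ∀ x ∈ σ, ρ i y ≤ ρ i x

/-- In a noncolourful set of `card I` points, the number of points whose removal leaves exactly the
colours other than `i₀` is even. -/
lemma even_card_filter_image_erase {I V : Type*} [Fintype I] [DecidableEq I] [DecidableEq V]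
    (c : V → I) (i₀ : I) (σ : Finset V) (hσ : σ.card = Fintype.card I)
    (hc : σ.image c ≠ univ) :
    Even (σ.filter fun x => (σ.erase x).image c = univ.erase i₀).card := by
  rcases (σ.filter fun x => (σ.erase x).image c = univ.erase i₀).eq_empty_or_nonempty with h | h
  · simp [h]
  obtain ⟨x, hx⟩ := h
  obtain ⟨hxσ, hx⟩ := mem_filter.1 hx
  have hcx : c x ≠ i₀ := by
    intro h
    apply hc
    rw [← insert_erase hxσ, image_insert, hx, h, insert_erase (mem_univ _)]
  have hinj : Set.InjOn c (σ.erase x : Finset V) := by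
    apply injOn_of_card_image_eq
    rw [hx, card_erase_of_mem hxσ, card_erase_of_mem (mem_univ _), hσ, card_univ]
  have : c x ∈ (σ.erase x).image c := by rw [hx]; simp [hcx]
  obtain ⟨x', hx', hcx'⟩ := mem_image.1 this
  have hne : x' ≠ x := ne_of_mem_erase hx'
  have hx'σ : x' ∈ σ := mem_of_mem_erase hx'
  have key : (σ.filter fun x => (σ.erase x).image c = univ.erase i₀) = {x, x'} := by
    ext y
    simp only [mem_filter, mem_insert, mem_singleton]
    constructor
    · rintro ⟨hy, hy'⟩
      by_contra! hcon
      have hyinj : Set.InjOn c (σ.erase y : Finset V) := by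
        apply injOn_of_card_image_eq
        rw [hy', card_erase_of_mem hy, card_erase_of_mem (mem_univ _), hσ, card_univ]
      exact hne (hyinj (by simp [hx'σ, hcon.2.symm]) (by simp [hxσ, hcon.1.symm]) hcx')
    · rintro (rfl | rfl)
      · exact ⟨hxσ, hx⟩
      · refine ⟨hx'σ, ?_⟩
        rw [← hx]
        ext j
        simp only [mem_image, mem_erase]
        constructor
        · rintro ⟨z, ⟨hz, hzσ⟩, rfl⟩
          by_cases hzx : z = x
          · exact ⟨y, ⟨hne, hx'σ⟩, by rw [hcx', hzx]⟩
          · exact ⟨z, ⟨hzx, hzσ⟩, rfl⟩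
        · rintro ⟨z, ⟨hz, hzσ⟩, rfl⟩
          by_cases hzx : z = y
          · exact ⟨x, ⟨hne.symm, hxσ⟩, by rw [← hcx', hzx]⟩
          · exact ⟨z, ⟨hzx, hzσ⟩, rfl⟩
  rw [key, card_pair hne.symm]
  exact even_two

/-- A set of `card I - 1` points, for which one can add a further point above all minima but any
given one, extends to a dominant set in an even number of ways. -/
lemma even_card_filter_isDominant_insert {I V β : Type*} [Fintype I] [DecidableEq I] [Nontrivial I]
    [Fintype V] [DecidableEq V] [LinearOrder β] (ρ : I → V → β)
    (hρ : ∀ i, Function.Injective (ρ i)) (τ : Finset V) (hτ : τ.card + 1 = Fintype.card I)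
    (hM : ∀ a, ∃ y, ∀ i, i ≠ a → ∃ x ∈ τ, ρ i x < ρ i y)
    [DecidablePred fun x => x ∉ τ ∧ IsDominant ρ (insert x τ)] :
    Even (univ.filter fun x => x ∉ τ ∧ IsDominant ρ (insert x τ)).card := by
  have hτne : τ.Nonempty := by
    rw [← card_pos]
    have := Fintype.one_lt_card (α := I)
    omega
  have hμ : ∀ i, ∃ x ∈ τ, ∀ y ∈ τ, ρ i x ≤ ρ i y := fun i => τ.exists_min_image (ρ i) hτne
  choose μ hμτ hμle using hμ
  replace hM : ∀ a, ∃ y, ∀ i, i ≠ a → ρ i (μ i) < ρ i y := by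
    intro a
    obtain ⟨y, hy⟩ := hM a
    refine ⟨y, fun i hi => ?_⟩
    obtain ⟨x, hx, hxy⟩ := hy i hi
    exact (hμle i x hx).trans_lt hxy
  -- every extension point is minimal for exactly one index
  have struct : ∀ x, x ∉ τ → IsDominant ρ (insert x τ) → ∃ a, ρ a x < ρ a (μ a) ∧
      (∀ i, i ≠ a → ρ i (μ i) < ρ i x) ∧ (∀ z ∈ τ, ∃ i, i ≠ a ∧ μ i = z) := by
    intro x hx hd
    have hm : ∀ i, ∃ z ∈ insert x τ, ∀ y ∈ insert x τ, ρ i z ≤ ρ i y := fun i =>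
      (insert x τ).exists_min_image (ρ i) (insert_nonempty _ _)
    choose m hmσ hmle using hm
    have hsurj : univ.image m = insert x τ := by
      apply Subset.antisymm
      · intro z hz
        obtain ⟨i, -, rfl⟩ := mem_image.1 hz
        exact hmσ i
      · intro z hz
        obtain ⟨i, hi⟩ := hd z
        refine mem_image.2 ⟨i, mem_univ _, ?_⟩
        exact hρ i (le_antisymm (hmle i z hz) (hi _ (hmσ i)))
    have hinj : Function.Injective m := by
      have : Set.InjOn m (univ : Finset I) := by
        apply injOn_of_card_image_eq
        rw [hsurj, card_insert_of_notMem hx, hτ, card_univ]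
      simpa [Set.injOn_univ] using this
    obtain ⟨a, -, ha⟩ := mem_image.1 (hsurj ▸ mem_insert_self x τ : x ∈ univ.image m)
    have hmμ : ∀ i, i ≠ a → m i = μ i := by
      intro i hi
      have : m i ∈ τ := by
        rcases mem_insert.1 (hmσ i) with h | h
        · exact absurd (hinj (h.trans ha.symm)) hi
        · exact h
      exact hρ i (le_antisymm (hmle i _ (mem_insert_of_mem (hμτ i))) (hμle i _ this))
    refine ⟨a, ?_, ?_, ?_⟩
    · refine lt_of_le_of_ne (ha ▸ hmle a _ (mem_insert_of_mem (hμτ a))) fun h => ?_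
      exact hx (hρ a h ▸ hμτ a)
    · intro i hi
      refine lt_of_le_of_ne (hmμ i hi ▸ hmle i _ (mem_insert_self _ _)) fun h => ?_
      exact hx (hρ i h ▸ hμτ i)
    · intro z hz
      obtain ⟨i, -, hi⟩ := mem_image.1 (hsurj ▸ mem_insert_of_mem hz : z ∈ univ.image m)
      have hia : i ≠ a := by
        rintro rfl
        exact hx (by rw [← ha, hi]; exact hz)
      exact ⟨i, hia, by rw [← hmμ i hia, hi]⟩
  rcases (univ.filter fun x => x ∉ τ ∧ IsDominant ρ (insert x τ)).eq_empty_or_nonempty with h | h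
  · simp [h]
  obtain ⟨x₀, hx₀⟩ := h
  obtain ⟨-, hx₀τ, hd₀⟩ := mem_filter.1 hx₀
  obtain ⟨a, -, -, hsa⟩ := struct x₀ hx₀τ hd₀
  have hdτ : ∀ y, ∃ i, ρ i y ≤ ρ i (μ i) := by
    intro y
    obtain ⟨i, hi⟩ := hd₀ y
    exact ⟨i, hi _ (mem_insert_of_mem (hμτ i))⟩
  obtain ⟨b, hba, hμab⟩ := hsa (μ a) (hμτ a)
  have hsb : ∀ z ∈ τ, ∃ i, i ≠ b ∧ μ i = z := by
    intro z hz
    obtain ⟨i, hi, hiz⟩ := hsa z hz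
    by_cases hib : i = b
    · exact ⟨a, hba.symm, by rw [← hμab, ← hib, hiz]⟩
    · exact ⟨i, hib, hiz⟩
  -- the index of an extension point is `a` or `b`
  have hab : ∀ a', (∀ z ∈ τ, ∃ i, i ≠ a' ∧ μ i = z) → a' = a ∨ a' = b := by
    intro a' ha'
    by_contra! hcon
    have himg : (univ.erase a').image μ = τ := by
      apply Subset.antisymm
      · intro z hz
        obtain ⟨i, -, rfl⟩ := mem_image.1 hz
        exact hμτ i
      · intro z hz
        obtain ⟨i, hi, rfl⟩ := ha' z hz
        exact mem_image_of_mem _ (by simp [hi])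
    have hinj : Set.InjOn μ (univ.erase a' : Finset I) := by
      apply injOn_of_card_image_eq
      rw [himg, card_erase_of_mem (mem_univ _), card_univ]
      omega
    exact hba (hinj (by simp [hcon.2.symm]) (by simp [hcon.1.symm]) hμab)
  -- for an index in the pair there is exactly one extension point
  have hex : ∀ a b, b ≠ a → μ b = μ a → (∀ z ∈ τ, ∃ i, i ≠ a ∧ μ i = z) →
      ∃ x, x ∉ τ ∧ IsDominant ρ (insert x τ) ∧ ρ a x < ρ a (μ a) ∧
      (∀ i, i ≠ a → ρ i (μ i) < ρ i x) ∧
      ∀ y, y ∉ τ → IsDominant ρ (insert y τ) → ρ a y < ρ a (μ a) →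
        (∀ i, i ≠ a → ρ i (μ i) < ρ i y) → y = x := by
    intro a b hba hμab hsa
    classical
    obtain ⟨y₀, hy₀⟩ := hM a
    obtain ⟨x, hx, hxmax⟩ := (univ.filter fun y => ∀ i, i ≠ a → ρ i (μ i) < ρ i y).exists_max_image
      (ρ a) ⟨y₀, by simpa using hy₀⟩
    replace hx : ∀ i, i ≠ a → ρ i (μ i) < ρ i x := by simpa using hx
    have hxτ : x ∉ τ := by
      intro h
      obtain ⟨i, hi, hix⟩ := hsa x h
      exact (hx i hi).ne (by rw [hix])
    have hxa : ρ a x < ρ a (μ a) := by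
      obtain ⟨i, hi⟩ := hdτ x
      by_cases hia : i = a
      · subst hia
        exact lt_of_le_of_ne hi fun h => hxτ (hρ _ h ▸ hμτ _)
      · exact absurd (hx i hia) hi.not_gt
    refine ⟨x, hxτ, ?_, hxa, hx, ?_⟩
    · intro y
      by_cases hy : ∀ i, i ≠ a → ρ i (μ i) < ρ i y
      · have hyx := hxmax y (by simpa using hy)
        refine ⟨a, fun z hz => ?_⟩
        rcases mem_insert.1 hz with rfl | hz
        · exact hyx
        · exact hyx.trans (hxa.le.trans (hμle a z hz))
      · push Not at hy
        obtain ⟨i, hi, hiy⟩ := hy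
        refine ⟨i, fun z hz => ?_⟩
        rcases mem_insert.1 hz with rfl | hz
        · exact hiy.trans (hx i hi).le
        · exact hiy.trans (hμle i z hz)
    · intro y hyτ hyd hya hyi
      apply hρ a
      apply le_antisymm (hxmax y (by simpa using hyi))
      obtain ⟨i, hi⟩ := hyd x
      by_cases hia : i = a
      · subst hia
        exact hi _ (mem_insert_self _ _)
      · exact absurd (hx i hia) (hi _ (mem_insert_of_mem (hμτ i))).not_gt
  obtain ⟨xa, hxaτ, hxad, hxa1, hxa2, hxau⟩ := hex a b hba hμab hsa
  obtain ⟨xb, hxbτ, hxbd, hxb1, hxb2, hxbu⟩ := hex b a hba.symm hμab.symm hsb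
  have hne : xa ≠ xb := by
    rintro rfl
    exact (hxb1.trans (hxa2 b hba)).false
  have key : (univ.filter fun x => x ∉ τ ∧ IsDominant ρ (insert x τ)) = {xa, xb} := by
    ext y
    simp only [mem_filter, mem_univ, true_and, mem_insert, mem_singleton]
    constructor
    · rintro ⟨hy, hyd⟩
      obtain ⟨a', h1, h2, h3⟩ := struct y hy hyd
      rcases hab a' h3 with rfl | rfl
      · exact Or.inl (hxau y hy hyd h1 h2)
      · exact Or.inr (hxbu y hy hyd h1 h2)
    · rintro (rfl | rfl)
      · exact ⟨hxaτ, hxad⟩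
      · exact ⟨hxbτ, hxbd⟩
  rw [key, card_pair hne]
  exact even_two

/-- **Scarf's lemma**, in the form of a Sperner lemma for families of linear orders. -/
theorem exists_isDominant_image_eq_univ {I V β : Type*} [Fintype I] [DecidableEq I] [Nontrivial I]
    [Fintype V] [DecidableEq V] [LinearOrder β] (ρ : I → V → β)
    (hρ : ∀ i, Function.Injective (ρ i)) (e : I → V) (he : Function.Injective e)
    (hmin : ∀ i v, ρ i (e i) ≤ ρ i v) (hmax : ∀ i j v, i ≠ j → v ∉ Set.range e → ρ i v < ρ i (e j))
    (hV : ∃ v, v ∉ Set.range e) (c : V → I) (hce : ∀ i, c (e i) = i) :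
    ∃ σ : Finset V, σ.card = Fintype.card I ∧ IsDominant ρ σ ∧ σ.image c = univ := by
  classical
  by_contra! hcon
  obtain ⟨i₀⟩ : Nonempty I := inferInstance
  set τ₀ : Finset V := (univ.erase i₀).image e with hτ₀
  let R : Finset (Finset V) := univ.filter fun σ => σ.card = Fintype.card I ∧ IsDominant ρ σ
  let D : Finset (Finset V) := univ.filter fun τ => τ.image c = univ.erase i₀ ∧
    τ.card + 1 = Fintype.card I
  let A := R.sigma fun σ => σ.filter fun x => (σ.erase x).image c = univ.erase i₀
  let B := D.sigma fun τ => univ.filter fun x => x ∉ τ ∧ IsDominant ρ (insert x τ)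
  have hA : Even A.card := by
    rw [card_sigma]
    refine even_sum _ fun σ hσ => ?_
    obtain ⟨-, h1, h2⟩ := mem_filter.1 hσ
    exact even_card_filter_image_erase c i₀ σ h1 (hcon σ h1 h2)
  have hAB : A.card = B.card := by
    refine card_bij' (fun s _ => ⟨s.1.erase s.2, s.2⟩) (fun s _ => ⟨insert s.2 s.1, s.2⟩) ?_ ?_ ?_ ?_
    · rintro ⟨σ, x⟩ h
      simp only [A, B, R, D, mem_sigma, mem_filter, mem_univ, true_and] at h ⊢
      obtain ⟨⟨h1, h2⟩, h3, h4⟩ := h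
      refine ⟨⟨h4, ?_⟩, by simp, by rwa [insert_erase h3]⟩
      rw [card_erase_add_one h3, h1]
    · rintro ⟨τ, x⟩ h
      simp only [A, B, R, D, mem_sigma, mem_filter, mem_univ, true_and] at h ⊢
      obtain ⟨⟨h1, h2⟩, h3, h4⟩ := h
      refine ⟨⟨by rw [card_insert_of_notMem h3, h2], h4⟩, by simp, by rwa [erase_insert h3]⟩
    · rintro ⟨σ, x⟩ h
      simp only [A, mem_sigma, mem_filter] at h
      simp [insert_erase h.2.1]
    · rintro ⟨τ, x⟩ h
      simp only [B, mem_sigma, mem_filter] at h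
      simp [erase_insert h.2.2.1]
  have hτ₀D : τ₀ ∈ D := by
    simp only [D, mem_filter, mem_univ, true_and]
    constructor
    · rw [hτ₀, image_image]
      ext j
      simp [hce]
    · rw [hτ₀, card_image_of_injective _ he, card_erase_add_one (mem_univ _), card_univ]
  have hmemτ₀ : ∀ v, v ∈ τ₀ ↔ ∃ i, i ≠ i₀ ∧ e i = v := by
    intro v
    simp [hτ₀]
  have hone : (univ.filter fun x => x ∉ τ₀ ∧ IsDominant ρ (insert x τ₀)).card = 1 := by
    obtain ⟨v₀, hv₀⟩ := hV
    obtain ⟨x, hx, hxmax⟩ := (univ.filter fun y => y ∉ τ₀).exists_max_image (ρ i₀) ⟨v₀, by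
      simp only [mem_filter, mem_univ, true_and, hmemτ₀]
      rintro ⟨i, -, h⟩
      exact hv₀ ⟨i, h⟩⟩
    replace hx : x ∉ τ₀ := by simpa using hx
    replace hxmax : ∀ y, y ∉ τ₀ → ρ i₀ y ≤ ρ i₀ x := fun y hy => hxmax y (by simpa using hy)
    rw [card_eq_one]
    refine ⟨x, ?_⟩
    ext y
    simp only [mem_filter, mem_univ, true_and, mem_singleton]
    constructor
    · rintro ⟨hy, hd⟩
      apply hρ i₀
      apply le_antisymm (hxmax y hy)
      obtain ⟨i, hi⟩ := hd x
      by_cases hii : i = i₀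
      · subst hii
        exact hi y (mem_insert_self _ _)
      · have hei : e i ∈ τ₀ := (hmemτ₀ _).2 ⟨i, hii, rfl⟩
        have := hρ i (le_antisymm (hi _ (mem_insert_of_mem hei)) (hmin i x))
        exact absurd (this ▸ hei) hx
    · rintro rfl
      refine ⟨hx, fun z => ?_⟩
      by_cases hz : z ∈ τ₀
      · obtain ⟨i, -, rfl⟩ := (hmemτ₀ z).1 hz
        exact ⟨i, fun w _ => hmin i w⟩
      · refine ⟨i₀, fun w hw => ?_⟩
        rcases mem_insert.1 hw with rfl | hw
        · exact hxmax z hz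
        · obtain ⟨j, hj, rfl⟩ := (hmemτ₀ w).1 hw
          by_cases hzr : z ∈ Set.range e
          · obtain ⟨k, rfl⟩ := hzr
            have : k = i₀ := by
              by_contra hk
              exact hz ((hmemτ₀ _).2 ⟨k, hk, rfl⟩)
            subst this
            exact hmin k _
          · exact (hmax i₀ j z hj.symm hzr).le
  have hB : Odd B.card := by
    rw [card_sigma, ← add_sum_erase _ _ hτ₀D, hone]
    refine Even.one_add (even_sum _ fun τ hτ => ?_)
    obtain ⟨hne, hτ⟩ := mem_erase.1 hτ
    obtain ⟨-, h1, h2⟩ := mem_filter.1 hτ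
    refine even_card_filter_isDominant_insert ρ hρ τ h2 fun a => ⟨e a, fun i hi => ?_⟩
    have : ∃ v ∈ τ, v ∉ Set.range e := by
      by_contra! hall
      apply hne
      refine eq_of_subset_of_card_le ?_ ?_
      · intro v hv
        obtain ⟨k, rfl⟩ := hall v hv
        refine (hmemτ₀ _).2 ⟨k, ?_, rfl⟩
        have : c (e k) ∈ univ.erase i₀ := h1 ▸ mem_image_of_mem c hv
        rw [hce] at this
        exact ne_of_mem_erase this
      · have := (mem_filter.1 hτ₀D).2.2
        omega
    obtain ⟨v, hv, hvr⟩ := this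
    exact ⟨v, hv, hmax i a v hi hvr⟩
  rw [hAB] at hA
  exact (Nat.not_even_iff_odd.2 hB) hA

/-- Discrete form of the Knaster–Kuratowski–Mazurkiewicz theorem: at every scale `1 / N` there is a
point of the simplex which, for each index `i`, is close to the `i`-th face or to the `i`-th set. -/
lemma exists_mem_stdSimplex_forall_near {I : Type*} [Fintype I] [Nontrivial I]
    (A : I → Set (I → ℝ)) (hcov : ∀ y ∈ stdSimplex ℝ I, ∃ i, y ∈ A i) (N : ℕ) (hN : 0 < N) :
    ∃ x ∈ stdSimplex ℝ I, ∀ i, x i ≤ Fintype.card I / N ∨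
      ∃ z ∈ stdSimplex ℝ I, z ∈ A i ∧ ∀ j, |z j - x j| ≤ Fintype.card I / N := by
  classical
  have hN' : (0 : ℝ) < N := by exact_mod_cast hN
  let G := {a : I → Fin (N + 1) // ∑ i, (a i : ℕ) = N}
  let V := G ⊕ I
  let key : I → V → ℕ := fun i v => Sum.elim (fun a => (a.1 i : ℕ) + 1)
    (fun j => if j = i then 0 else N + 2) v
  let ρ : I → V → ℕ ×ₗ Fin (Fintype.card V) := fun i v => toLex (key i v, Fintype.equivFin V v)
  have hρ : ∀ i, Function.Injective (ρ i) := by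
    intro i v w h
    have := congrArg (fun z => (ofLex z).2) h
    exact (Fintype.equivFin V).injective this
  have hρlt : ∀ i v w, key i v < key i w → ρ i v < ρ i w := fun i v w h =>
    Prod.Lex.toLex_lt_toLex.2 (Or.inl h)
  have hρle : ∀ i v w, ρ i v ≤ ρ i w → key i v ≤ key i w := by
    intro i v w h
    by_contra! hlt
    exact (hρlt i w v hlt).not_ge h
  have hmin : ∀ i v, ρ i (Sum.inr i) ≤ ρ i v := by
    rintro i (a | j)
    · exact (hρlt _ _ _ (by simp [key])).le
    · by_cases hij : j = i
      · rw [hij]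
      · exact (hρlt _ _ _ (by simp [key, hij])).le
  have hmax : ∀ i j v, i ≠ j → v ∉ Set.range (Sum.inr : I → V) → ρ i v < ρ i (Sum.inr j) := by
    rintro i j (a | k) hij hv
    · apply hρlt
      have := (a.1 i).2
      simp only [key, Sum.elim_inl, Sum.elim_inr, if_neg hij.symm]
      omega
    · exact absurd ⟨k, rfl⟩ hv
  let pt : G → I → ℝ := fun a i => (a.1 i : ℕ) / N
  have hpt : ∀ a, pt a ∈ stdSimplex ℝ I := by
    intro a
    refine ⟨fun i => by positivity, ?_⟩
    simp only [pt]
    rw [← sum_div, ← Nat.cast_sum, a.2, div_self hN'.ne']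
  choose! col hcol using hcov
  have hmk : ∀ f : I → ℕ, ∑ i, f i = N → ∃ a : G, ∀ i, (a.1 i : ℕ) = f i := by
    intro f hf
    refine ⟨⟨fun i => ⟨f i, ?_⟩, hf⟩, fun i => rfl⟩
    have := single_le_sum (f := f) (fun _ _ => Nat.zero_le _) (mem_univ i)
    omega
  obtain ⟨i₁⟩ : Nonempty I := inferInstance
  obtain ⟨a₀, -⟩ := hmk (Pi.single i₁ N) (by simp)
  obtain ⟨σ, hσ, hd, himg⟩ := exists_isDominant_image_eq_univ ρ hρ (Sum.inr : I → V)
    Sum.inr_injective hmin hmax ⟨Sum.inl a₀, by simp⟩ (Sum.elim (fun a => col (pt a)) id)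
    (fun i => rfl)
  -- the room contains a grid point
  have hgrid : ∃ a : G, Sum.inl a ∈ σ := by
    by_contra! hcon
    have hall : ∀ i, (Sum.inr i : V) ∈ σ := by
      intro i
      have : i ∈ σ.image (Sum.elim (fun a => col (pt a)) id : V → I) := himg ▸ mem_univ i
      obtain ⟨v | j, hv, hvi⟩ := mem_image.1 this
      · exact absurd hv (hcon v)
      · have : j = i := hvi
        exact this ▸ hv
    obtain ⟨i, hi⟩ := hd (Sum.inl a₀)
    have := hρle _ _ _ (hi _ (hall i))
    simp [key] at this
  obtain ⟨a₁, ha₁⟩ := hgrid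
  let σG : Finset G := univ.filter fun a => Sum.inl a ∈ σ
  have hσG : ∀ a, a ∈ σG ↔ (Sum.inl a : V) ∈ σ := by simp [σG]
  let C : Finset I := univ.filter fun i => (Sum.inr i : V) ∉ σ
  have hC : ∀ i, i ∈ C ↔ (Sum.inr i : V) ∉ σ := by simp [C]
  have hmin' : ∀ i, ∃ a ∈ σG, ∀ b ∈ σG, (a.1 i : ℕ) ≤ b.1 i := fun i =>
    σG.exists_min_image (fun a => (a.1 i : ℕ)) ⟨a₁, (hσG _).2 ha₁⟩
  choose m hmσ hmle using hmin'
  have hCne : C.Nonempty := by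
    by_contra hcon
    rw [not_nonempty_iff_eq_empty] at hcon
    have hsub : univ.image (Sum.inr : I → V) ⊆ σ := by
      intro v hv
      obtain ⟨i, -, rfl⟩ := mem_image.1 hv
      by_contra h
      simpa [hcon] using (hC i).2 h
    have heq := eq_of_subset_of_card_le hsub (by
      rw [card_image_of_injective _ Sum.inr_injective, hσ, card_univ])
    rw [← heq] at ha₁
    simp at ha₁
  have hsum : N < ∑ i ∈ C, ((m i).1 i + 1 : ℕ) := by
    by_contra! hcon
    obtain ⟨i₂, hi₂⟩ := hCne
    obtain ⟨y, hy⟩ := hmk (fun i => (if i ∈ C then (((m i).1 i : ℕ) + 1) else 0) +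
      (if i = i₂ then N - ∑ i ∈ C, ((m i).1 i + 1 : ℕ) else 0)) (by
        rw [sum_add_distrib, sum_ite_mem, univ_inter, sum_ite_eq' univ i₂, if_pos (mem_univ _)]
        omega)
    obtain ⟨i, hi⟩ := hd (Sum.inl y)
    by_cases hiC : i ∈ C
    · have h1 := hρle _ _ _ (hi _ ((hσG _).1 (hmσ i)))
      simp only [key, Sum.elim_inl] at h1
      have := hy i
      rw [if_pos hiC] at this
      omega
    · have h1 := hρle _ _ _ (hi _ (not_not.1 (mt (hC i).2 hiC)))
      simp [key] at h1
  have hCcard : C.card ≤ Fintype.card I := card_le_univ C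
  rw [sum_add_distrib, sum_const, smul_eq_mul, mul_one] at hsum
  have hdev : ∀ a ∈ σG, (∀ i ∈ C, (a.1 i : ℕ) ≤ (m i).1 i + Fintype.card I) ∧
      ∀ i, i ∉ C → (a.1 i : ℕ) ≤ Fintype.card I := by
    intro a ha
    have htot := a.2
    rw [← sum_add_sum_compl C] at htot
    have hle : ∀ i ∈ C, ((m i).1 i : ℕ) ≤ a.1 i := fun i _ => hmle i a ha
    have hle' := sum_le_sum hle
    constructor
    · intro i hi
      have h1 := add_sum_erase C (fun i => (a.1 i : ℕ)) hi
      have h2 := add_sum_erase C (fun i => ((m i).1 i : ℕ)) hi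
      have h3 : ∑ i ∈ C.erase i, ((m i).1 i : ℕ) ≤ ∑ i ∈ C.erase i, (a.1 i : ℕ) :=
        sum_le_sum fun j hj => hle j (mem_of_mem_erase hj)
      omega
    · intro i hi
      have h1 := single_le_sum (f := fun i => (a.1 i : ℕ)) (s := Cᶜ) (fun _ _ => Nat.zero_le _)
        (mem_compl.2 hi)
      omega
  refine ⟨pt a₁, hpt a₁, fun i => ?_⟩
  by_cases hi : i ∈ C
  · right
    have : i ∈ σ.image (Sum.elim (fun a => col (pt a)) id : V → I) := himg ▸ mem_univ i
    obtain ⟨a | j, hv, hvi⟩ := mem_image.1 this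
    · have hai : col (pt a) = i := hvi
      refine ⟨pt a, hpt a, hai ▸ hcol _ (hpt a), fun j => ?_⟩
      simp only [pt]
      rw [← sub_div, abs_div, abs_of_pos hN']
      gcongr
      have ha := hdev a ((hσG _).2 hv)
      have hb := hdev a₁ ((hσG _).2 ha₁)
      have h1 : (a.1 j : ℕ) ≤ a₁.1 j + Fintype.card I ∧ (a₁.1 j : ℕ) ≤ a.1 j + Fintype.card I := by
        by_cases hj : j ∈ C
        · have e1 := ha.1 j hj
          have e2 := hb.1 j hj
          have e3 := hmle j a ((hσG _).2 hv)
          have e4 := hmle j a₁ ((hσG _).2 ha₁)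
          omega
        · have e1 := ha.2 j hj
          have e2 := hb.2 j hj
          omega
      rw [abs_le]
      have e1 : ((a.1 j : ℕ) : ℝ) ≤ (a₁.1 j : ℕ) + Fintype.card I := by exact_mod_cast h1.1
      have e2 : ((a₁.1 j : ℕ) : ℝ) ≤ (a.1 j : ℕ) + Fintype.card I := by exact_mod_cast h1.2
      constructor <;> linarith
    · have : j = i := hvi
      exact absurd (this ▸ hv) ((hC i).1 hi)
  · left
    simp only [pt]
    gcongr
    exact_mod_cast (hdev a₁ ((hσG _).2 ha₁)).2 i hi

/-- A Knaster–Kuratowski–Mazurkiewicz theorem: closed sets covering the simplex, such that the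
`i`-th one contains the face `x i = 0`, have a common point. -/
theorem exists_mem_stdSimplex_forall_mem {I : Type*} [Fintype I] [Nontrivial I]
    (A : I → Set (I → ℝ)) (hA : ∀ i, IsClosed (A i))
    (hcov : ∀ y ∈ stdSimplex ℝ I, ∃ i, y ∈ A i)
    (hface : ∀ y ∈ stdSimplex ℝ I, ∀ i, y i = 0 → y ∈ A i) :
    ∃ y ∈ stdSimplex ℝ I, ∀ i, y ∈ A i := by
  choose x hxΔ hx using fun N : ℕ => exists_mem_stdSimplex_forall_near A hcov (N + 1) N.succ_pos
  obtain ⟨y, hy, φ, hφ, hlim⟩ := (isCompact_stdSimplex ℝ I).tendsto_subseq hxΔ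
  refine ⟨y, hy, fun i => ?_⟩
  by_contra hyi
  have hypos : 0 < y i := lt_of_le_of_ne (hy.1 i) fun h => hyi (hface y hy i h.symm)
  obtain ⟨ε, hε, hball⟩ := Metric.isOpen_iff.1 (hA i).isOpen_compl y hyi
  have herr : Filter.Tendsto (fun N : ℕ => (Fintype.card I : ℝ) / ((φ N + 1 : ℕ) : ℝ)) Filter.atTop
      (nhds 0) :=
    ((tendsto_const_div_atTop_nhds_zero_nat (Fintype.card I : ℝ)).comp
      (Filter.tendsto_add_atTop_nat 1)).comp hφ.tendsto_atTop
  obtain ⟨N, h1, h2, h3, h4⟩ := ((herr.eventually_lt_const (half_pos hε)).and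
    ((herr.eventually_lt_const (half_pos hypos)).and
    ((Metric.tendsto_nhds.1 hlim _ (half_pos hε)).and
    (Metric.tendsto_nhds.1 hlim _ (half_pos hypos))))).exists
  rcases hx (φ N) i with h | ⟨z, -, hzA, hz⟩
  · have := (dist_le_pi_dist _ _ i).trans_lt h4
    rw [Real.dist_eq, abs_lt] at this
    simp only [Function.comp] at this
    linarith [this.1]
  · refine hball ?_ hzA
    rw [Metric.mem_ball]
    have hzx : dist z (x (φ N)) < ε / 2 := by
      refine (dist_pi_lt_iff (half_pos hε)).2 fun j => ?_
      rw [Real.dist_eq]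
      exact (hz j).trans_lt h1
    calc dist z y ≤ dist z (x (φ N)) + dist (x (φ N)) y := dist_triangle _ _ _
      _ < ε / 2 + ε / 2 := add_lt_add hzx h3
      _ = ε := add_halves ε

/-- The potential of the measure `q + kh * leftPot` restricted to the left of each point. -/
def leftPot (κ kh q : ℕ → ℝ) (j : ℕ) : ℝ :=
  ∑ a ∈ (Icc 1 (j - 1)).attach, (κ j - κ a) * (q a + kh a * leftPot κ kh q a)
termination_by j
decreasing_by
  have := mem_Icc.1 a.2
  omega

/-- The potential of the measure `q + kh * rightPot` restricted to the right of each point. -/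
def rightPot (M : ℕ) (κ kh q : ℕ → ℝ) (j : ℕ) : ℝ :=
  ∑ a ∈ (Icc (j + 1) M).attach, (κ a - κ j) * (q a + kh a * rightPot M κ kh q a)
termination_by M - j
decreasing_by
  have := mem_Icc.1 a.2
  omega

/-- The potential of the G-system, as the minimum of the left and right potentials. -/
def midPot (M : ℕ) (κ kh q : ℕ → ℝ) (j : ℕ) : ℝ :=
  if 2 ≤ j ∧ j ≤ M - 1 then min (leftPot κ kh q j) (rightPot M κ kh q j) else 0

lemma leftPot_eq (κ kh q : ℕ → ℝ) (j : ℕ) : leftPot κ kh q j =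
    ∑ a ∈ Icc 1 (j - 1), (κ j - κ a) * (q a + kh a * leftPot κ kh q a) := by
  rw [leftPot, sum_attach (Icc 1 (j - 1))
    fun a => (κ j - κ a) * (q a + kh a * leftPot κ kh q a)]

lemma rightPot_eq (M : ℕ) (κ kh q : ℕ → ℝ) (j : ℕ) : rightPot M κ kh q j =
    ∑ a ∈ Icc (j + 1) M, (κ a - κ j) * (q a + kh a * rightPot M κ kh q a) := by
  rw [rightPot, sum_attach (Icc (j + 1) M)
    fun a => (κ a - κ j) * (q a + kh a * rightPot M κ kh q a)]

lemma leftPot_succ (κ kh q : ℕ → ℝ) (j : ℕ) : leftPot κ kh q (j + 1) =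
    leftPot κ kh q j + (κ (j + 1) - κ j) * ∑ a ∈ Icc 1 j, (q a + kh a * leftPot κ kh q a) := by
  rcases j with _ | j
  · simp [leftPot_eq κ kh q 0, leftPot_eq κ kh q 1]
  · rw [leftPot_eq κ kh q (j + 1 + 1), leftPot_eq κ kh q (j + 1), mul_sum]
    simp only [Nat.add_sub_cancel]
    have : Icc 1 (j + 1) = insert (j + 1) (Icc 1 j) := by ext; simp; omega
    rw [this, sum_insert (by simp), sum_insert (by simp), add_left_comm, ← sum_add_distrib]
    congr 1
    refine sum_congr rfl fun a _ => ?_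
    ring

lemma rightPot_succ (M : ℕ) (κ kh q : ℕ → ℝ) (j : ℕ) (hj : j + 1 ≤ M) : rightPot M κ kh q j =
    rightPot M κ kh q (j + 1) +
      (κ (j + 1) - κ j) * ∑ a ∈ Icc (j + 1) M, (q a + kh a * rightPot M κ kh q a) := by
  rw [rightPot_eq M κ kh q j, rightPot_eq M κ kh q (j + 1), mul_sum]
  have : Icc (j + 1) M = insert (j + 1) (Icc (j + 1 + 1) M) := by ext; simp; omega
  rw [this, sum_insert (by simp), sum_insert (by simp), add_left_comm, ← sum_add_distrib]
  congr 1
  refine sum_congr rfl fun a _ => ?_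
  ring

lemma leftPot_nonneg {M : ℕ} {κ kh q : ℕ → ℝ} (hκ : StrictMonoOn κ (Set.Icc 1 M))
    (hkh : ∀ a, 0 ≤ kh a) (hq : ∀ a, 1 ≤ a → a ≤ M → 0 ≤ q a) (j : ℕ) (hj : j ≤ M) :
    0 ≤ leftPot κ kh q j := by
  induction j using Nat.strong_induction_on with
  | _ j ih =>
    rw [leftPot_eq]
    refine sum_nonneg fun a ha => ?_
    obtain ⟨h1, h2⟩ := mem_Icc.1 ha
    have h3 : κ a < κ j := hκ ⟨h1, by omega⟩ ⟨by omega, hj⟩ (by omega)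
    have h4 := ih a (by omega) (by omega)
    have h5 := hq a h1 (by omega)
    have h6 := hkh a
    have : 0 ≤ κ j - κ a := by linarith
    positivity

lemma rightPot_nonneg {M : ℕ} {κ kh q : ℕ → ℝ} (hκ : StrictMonoOn κ (Set.Icc 1 M))
    (hkh : ∀ a, 0 ≤ kh a) (hq : ∀ a, 1 ≤ a → a ≤ M → 0 ≤ q a) (j : ℕ) (hj : 1 ≤ j) :
    0 ≤ rightPot M κ kh q j := by
  induction hn : M - j using Nat.strong_induction_on generalizing j with
  | _ n ih =>
    rw [rightPot_eq]
    refine sum_nonneg fun a ha => ?_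
    obtain ⟨h1, h2⟩ := mem_Icc.1 ha
    have h3 : κ j < κ a := hκ ⟨hj, by omega⟩ ⟨by omega, h2⟩ (by omega)
    have h4 := ih (M - a) (by omega) a (by omega) rfl
    have h5 := hq a (by omega) h2
    have h6 := hkh a
    have : 0 ≤ κ a - κ j := by linarith
    positivity

lemma leftPot_continuousOn {Y : Type*} [TopologicalSpace Y] {S : Set Y} (κ kh : ℕ → ℝ)
    (q : Y → ℕ → ℝ) (hq : ∀ a, ContinuousOn (fun y => q y a) S) (j : ℕ) :
    ContinuousOn (fun y => leftPot κ kh (q y) j) S := by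
  induction j using Nat.strong_induction_on with
  | _ j ih =>
    simp_rw [leftPot_eq κ kh _ j]
    refine continuousOn_finsetSum _ fun a ha => ?_
    obtain ⟨h1, h2⟩ := mem_Icc.1 ha
    exact continuousOn_const.mul ((hq a).add (continuousOn_const.mul (ih a (by omega))))

lemma rightPot_continuousOn {Y : Type*} [TopologicalSpace Y] {S : Set Y} (M : ℕ) (κ kh : ℕ → ℝ)
    (q : Y → ℕ → ℝ) (hq : ∀ a, ContinuousOn (fun y => q y a) S) (j : ℕ) :
    ContinuousOn (fun y => rightPot M κ kh (q y) j) S := by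
  induction hn : M - j using Nat.strong_induction_on generalizing j with
  | _ n ih =>
    simp_rw [rightPot_eq M κ kh _ j]
    refine continuousOn_finsetSum _ fun a ha => ?_
    obtain ⟨h1, h2⟩ := mem_Icc.1 ha
    exact continuousOn_const.mul ((hq a).add
      (continuousOn_const.mul (ih (M - a) (by omega) a rfl)))

lemma midPot_continuousOn {Y : Type*} [TopologicalSpace Y] {S : Set Y} (M : ℕ) (κ kh : ℕ → ℝ)
    (q : Y → ℕ → ℝ) (hq : ∀ a, ContinuousOn (fun y => q y a) S) (j : ℕ) :
    ContinuousOn (fun y => midPot M κ kh (q y) j) S := by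
  unfold midPot
  split_ifs
  · exact (leftPot_continuousOn κ kh q hq j).inf (rightPot_continuousOn M κ kh q hq j)
  · exact continuousOn_const

lemma leftPot_pos {M : ℕ} {κ kh q : ℕ → ℝ} (hκ : StrictMonoOn κ (Set.Icc 1 M))
    (hkh : ∀ a, 0 ≤ kh a) (hq : ∀ a, 1 ≤ a → a ≤ M → 0 < q a) (j : ℕ) (h2 : 2 ≤ j) (hj : j ≤ M) :
    0 < leftPot κ kh q j := by
  rw [leftPot_eq]
  refine sum_pos (fun a ha => ?_) ⟨1, mem_Icc.2 (by omega)⟩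
  obtain ⟨h1, h2⟩ := mem_Icc.1 ha
  have h3 : κ a < κ j := hκ ⟨h1, by omega⟩ ⟨by omega, hj⟩ (by omega)
  have h4 := leftPot_nonneg hκ hkh (fun a h h' => (hq a h h').le) a (by omega)
  have h5 := hq a h1 (by omega)
  have h6 := hkh a
  have : 0 < κ j - κ a := by linarith
  positivity

lemma rightPot_pos {M : ℕ} {κ kh q : ℕ → ℝ} (hκ : StrictMonoOn κ (Set.Icc 1 M))
    (hkh : ∀ a, 0 ≤ kh a) (hq : ∀ a, 1 ≤ a → a ≤ M → 0 < q a) (j : ℕ) (hj : 1 ≤ j)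
    (hjM : j + 1 ≤ M) : 0 < rightPot M κ kh q j := by
  rw [rightPot_eq]
  refine sum_pos (fun a ha => ?_) ⟨M, mem_Icc.2 (by omega)⟩
  obtain ⟨h1, h2⟩ := mem_Icc.1 ha
  have h3 : κ j < κ a := hκ ⟨hj, by omega⟩ ⟨by omega, h2⟩ (by omega)
  have h4 := rightPot_nonneg hκ hkh (fun a h h' => (hq a h h').le) a (by omega)
  have h5 := hq a (by omega) h2
  have h6 := hkh a
  have : 0 < κ a - κ j := by linarith
  positivity

lemma midPot_pos {M : ℕ} {κ kh q : ℕ → ℝ} (hκ : StrictMonoOn κ (Set.Icc 1 M))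
    (hkh : ∀ a, 0 ≤ kh a) (hq : ∀ a, 1 ≤ a → a ≤ M → 0 < q a) (j : ℕ) (h2 : 2 ≤ j)
    (hj : j ≤ M - 1) : 0 < midPot M κ kh q j := by
  rw [midPot, if_pos ⟨h2, hj⟩]
  exact lt_min (leftPot_pos hκ hkh hq j h2 (by omega))
    (rightPot_pos hκ hkh hq j (by omega) (by omega))

/-- The left and right potentials cross between `l - 1` and `l`. -/
lemma exists_crossing {M : ℕ} (hM : 3 ≤ M) {κ kh q : ℕ → ℝ} (hκ : StrictMonoOn κ (Set.Icc 1 M))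
    (hkh : ∀ a, 0 ≤ kh a) (hq : ∀ a, 1 ≤ a → a ≤ M → 0 < q a) :
    ∃ l, 2 ≤ l ∧ l ≤ M ∧ (∀ j, j + 1 ≤ l → midPot M κ kh q j = leftPot κ kh q j) ∧
      (∀ j, l ≤ j → midPot M κ kh q j = rightPot M κ kh q j) ∧
      leftPot κ kh q (l - 1) < rightPot M κ kh q (l - 1) ∧
      rightPot M κ kh q l ≤ leftPot κ kh q l := by
  have hq' : ∀ a, 1 ≤ a → a ≤ M → 0 ≤ q a := fun a h h' => (hq a h h').le
  have hL0 : leftPot κ kh q 0 = 0 := by rw [leftPot_eq]; simp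
  have hL1 : leftPot κ kh q 1 = 0 := by rw [leftPot_eq]; simp
  have hRM : ∀ j, M ≤ j → rightPot M κ kh q j = 0 := by
    intro j hj
    rw [rightPot_eq, Icc_eq_empty (by omega), sum_empty]
  have hex : ∃ l, 2 ≤ l ∧ rightPot M κ kh q l ≤ leftPot κ kh q l :=
    ⟨M, by omega, by rw [hRM M le_rfl]; exact leftPot_nonneg hκ hkh hq' M le_rfl⟩
  classical
  obtain ⟨hl2, hl⟩ := Nat.find_spec hex
  have hlM : Nat.find hex ≤ M := Nat.find_min' hex
    ⟨by omega, by rw [hRM M le_rfl]; exact leftPot_nonneg hκ hkh hq' M le_rfl⟩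
  set l := Nat.find hex with hldef
  have hlt : ∀ j, 2 ≤ j → j < l → leftPot κ kh q j < rightPot M κ kh q j := by
    intro j h2 hj
    have := Nat.find_min hex hj
    push Not at this
    exact this h2
  have hge : ∀ j, l ≤ j → j ≤ M → rightPot M κ kh q j ≤ leftPot κ kh q j := by
    intro j hj
    induction j, hj using Nat.le_induction with
    | base => exact fun _ => hl
    | succ j hj ih =>
      intro hjM
      have h1 := ih (by omega)
      have h2 := leftPot_succ κ kh q j
      have h3 := rightPot_succ M κ kh q j hjM
      have h4 : κ j < κ (j + 1) := hκ ⟨by omega, by omega⟩ ⟨by omega, hjM⟩ (by omega)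
      have h5 : 0 ≤ ∑ a ∈ Icc 1 j, (q a + kh a * leftPot κ kh q a) := by
        refine sum_nonneg fun a ha => ?_
        obtain ⟨h1, h2⟩ := mem_Icc.1 ha
        have h4 := leftPot_nonneg hκ hkh hq' a (by omega)
        have h5 := hq' a (by omega) (by omega)
        have h6 := hkh a
        positivity
      have h6 : 0 ≤ ∑ a ∈ Icc (j + 1) M, (q a + kh a * rightPot M κ kh q a) := by
        refine sum_nonneg fun a ha => ?_
        obtain ⟨h1, h2⟩ := mem_Icc.1 ha
        have h4 := rightPot_nonneg hκ hkh hq' a (by omega)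
        have h5 := hq' a (by omega) (by omega)
        have h6 := hkh a
        positivity
      nlinarith [mul_nonneg (sub_nonneg.2 h4.le) h5, mul_nonneg (sub_nonneg.2 h4.le) h6]
  refine ⟨l, hl2, hlM, ?_, ?_, ?_, hl⟩
  · intro j hj
    unfold midPot
    split_ifs with h
    · exact min_eq_left (hlt j h.1 (by omega)).le
    · have : j = 0 ∨ j = 1 := by omega
      rcases this with rfl | rfl
      · exact hL0.symm
      · exact hL1.symm
  · intro j hj
    unfold midPot
    split_ifs with h
    · exact min_eq_right (hge j hj (by omega))
    · exact (hRM j (by omega)).symm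
  · by_cases h : l = 2
    · rw [h, hL1]
      exact rightPot_pos hκ hkh hq 1 le_rfl (by omega)
    · exact hlt _ (by omega) (by omega)

/-- The row vector `q * τ` multiplied by the generator whose potential is `F`. -/
def potStep (κ kh q F τ : ℕ → ℝ) (j : ℕ) : ℝ :=
  τ j * (q j + kh j * F j + F j / (κ (j + 1) - κ j) + F j / (κ j - κ (j - 1))) -
    τ (j - 1) * (F (j - 1) / (κ j - κ (j - 1))) - τ (j + 1) * (F (j + 1) / (κ (j + 1) - κ j))

/-- The geometric weights used as a supersolution, centred at `c`. -/
def centredWeight (T K : ℝ) (M c j : ℕ) : ℝ :=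
  T + ∑ a ∈ Ico j c, K ^ a + ∑ a ∈ Ioc c j, K ^ (M + 1 - a)

lemma centredWeight_self (T K : ℝ) (M c : ℕ) : centredWeight T K M c c = T := by
  simp [centredWeight]

lemma centredWeight_left (T K : ℝ) {M c j : ℕ} (h : j < c) :
    centredWeight T K M c j = centredWeight T K M c (j + 1) + K ^ j := by
  rw [centredWeight, centredWeight, Ioc_eq_empty (by omega), Ioc_eq_empty (by omega),
    sum_eq_sum_Ico_succ_bot h]
  ring

lemma centredWeight_right (T K : ℝ) {M c j : ℕ} (h : c ≤ j) :
    centredWeight T K M c (j + 1) = centredWeight T K M c j + K ^ (M - j) := by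
  rw [centredWeight, centredWeight, Ico_eq_empty (by omega), Ico_eq_empty (by omega),
    sum_Ioc_succ_top h]
  simp only [Nat.add_sub_add_right]
  ring

lemma centredWeight_nonneg {T K : ℝ} (hT : 0 ≤ T) (hK : 0 ≤ K) (M c j : ℕ) :
    0 ≤ centredWeight T K M c j := by
  unfold centredWeight
  positivity

lemma centredWeight_le {T K : ℝ} (hK : 1 ≤ K) {M c j : ℕ} (hj : j ≤ M) (hc : c ≤ M) :
    centredWeight T K M c j ≤ T + M * K ^ M + M * K ^ M := by
  unfold centredWeight
  have hK' : 0 ≤ K ^ M := by positivity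
  gcongr
  · calc ∑ a ∈ Ico j c, K ^ a ≤ ∑ a ∈ Ico j c, K ^ M :=
        sum_le_sum fun a ha => pow_le_pow_right₀ hK (by have := mem_Ico.1 ha; omega)
      _ = ((c - j : ℕ) : ℝ) * K ^ M := by simp
      _ ≤ M * K ^ M := by
        gcongr
        omega
  · calc ∑ a ∈ Ioc c j, K ^ (M + 1 - a) ≤ ∑ a ∈ Ioc c j, K ^ M :=
        sum_le_sum fun a ha => pow_le_pow_right₀ hK (by have := mem_Ioc.1 ha; omega)
      _ = ((j - c : ℕ) : ℝ) * K ^ M := by simp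
      _ ≤ M * K ^ M := by
        gcongr
        omega

/-- The supersolution inequality at a point away from the centre. -/
lemma weight_ineq_off_centre {D θ' τ q E b b' : ℝ} (hD : 1 ≤ D) (hθ' : 1 ≤ θ')
    (hτ : 2 * D * θ' ≤ τ) (hqE : q ≤ E) (hE : 0 ≤ E) (hbE : b ≤ E) (hb' : b' ≤ D * E) :
    q ≤ τ * (b' + E) - (τ + θ') * b' - (τ - 2 * D * θ') * b := by
  have h1 : 0 ≤ (τ - 2 * D * θ') * (E - b) := mul_nonneg (by linarith) (by linarith)
  have h2 : θ' * b' ≤ θ' * (D * E) := by gcongr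
  have h3 : 1 * E ≤ (D * θ') * E := by
    gcongr
    nlinarith
  nlinarith

/-- The supersolution inequality at the centre. -/
lemma weight_ineq_centre {D P θ₁ θ₂ q m v b₁ b₂ : ℝ} (hD : 1 ≤ D)
    (hθ₁ : 0 ≤ θ₁) (hθ₂ : 0 ≤ θ₂) (hθ₁P : θ₁ ≤ P) (hθ₂P : θ₂ ≤ P) (hq : q ≤ m) (hm : 0 ≤ m)
    (hv : m / 2 ≤ v) (hb₁ : b₁ ≤ D * m) (hb₂ : b₂ ≤ D * m) :
    q ≤ (2 + 4 * (P * D)) * (v + b₁ + b₂) - ((2 + 4 * (P * D)) + θ₁) * b₁ -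
      ((2 + 4 * (P * D)) + θ₂) * b₂ := by
  have hDm : 0 ≤ D * m := by positivity
  have h1 : θ₁ * b₁ ≤ P * (D * m) :=
    (mul_le_mul_of_nonneg_left hb₁ hθ₁).trans (mul_le_mul_of_nonneg_right hθ₁P hDm)
  have h2 : θ₂ * b₂ ≤ P * (D * m) :=
    (mul_le_mul_of_nonneg_left hb₂ hθ₂).trans (mul_le_mul_of_nonneg_right hθ₂P hDm)
  have hPD : 0 ≤ P * D := mul_nonneg (hθ₁.trans hθ₁P) (by linarith)
  have h3 : (2 + 4 * (P * D)) * (m / 2) ≤ (2 + 4 * (P * D)) * v := by gcongr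
  nlinarith

lemma exists_pos_supersolution {M : ℕ} (hM : 3 ≤ M) {κ kh : ℕ → ℝ}
    (hκ : StrictMonoOn κ (Set.Icc 1 M)) (hkh : ∀ a, 0 ≤ kh a) :
    ∃ C, 0 < C ∧ ∀ q : ℕ → ℝ, (∀ a, 1 ≤ a → a ≤ M → 0 < q a) → ∃ τ : ℕ → ℝ,
      ∀ j, 1 ≤ j → j ≤ M → 0 ≤ τ j ∧ τ j ≤ C ∧
        q j ≤ potStep κ kh q (midPot M κ kh q) τ j := by
  have hΔ : ∀ j, 1 ≤ j → j + 1 ≤ M → 0 < κ (j + 1) - κ j := fun j h1 h2 =>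
    sub_pos.2 (hκ ⟨h1, by omega⟩ ⟨by omega, h2⟩ (by omega))
  have hκle : ∀ a b, 1 ≤ a → a ≤ b → b ≤ M → κ a ≤ κ b := fun a b h1 h2 h3 =>
    hκ.monotoneOn ⟨h1, by omega⟩ ⟨by omega, h3⟩ h2
  obtain ⟨D, hD1, hD⟩ : ∃ D : ℝ, 1 ≤ D ∧ ∀ j, 1 ≤ j → j + 1 ≤ M →
      κ M - κ 1 ≤ D * (κ (j + 1) - κ j) := by
    have hnn : ∀ a ∈ Icc 1 (M - 1), 0 ≤ (κ M - κ 1) / (κ (a + 1) - κ a) := by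
      intro a ha
      obtain ⟨h1, h2⟩ := mem_Icc.1 ha
      exact div_nonneg (sub_nonneg.2 (hκle 1 M le_rfl (by omega) le_rfl))
        (hΔ a h1 (by omega)).le
    refine ⟨1 + ∑ a ∈ Icc 1 (M - 1), (κ M - κ 1) / (κ (a + 1) - κ a), ?_, fun j h1 h2 => ?_⟩
    · linarith [sum_nonneg hnn]
    · rw [← div_le_iff₀ (hΔ j h1 h2)]
      linarith [single_le_sum hnn (mem_Icc.2 ⟨h1, by omega⟩ : j ∈ Icc 1 (M - 1))]
  set K := 2 * D with hK
  have hK1 : 1 ≤ K := by linarith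
  set T := 2 + 4 * (K ^ M * D) with hT
  have hT0 : 0 ≤ T := by positivity
  refine ⟨T + M * K ^ M + M * K ^ M, by positivity, fun q hq => ?_⟩
  have hq' : ∀ a, 1 ≤ a → a ≤ M → 0 ≤ q a := fun a h h' => (hq a h h').le
  obtain ⟨l, hl2, hlM, hFL, hFR, hlt, hge⟩ := exists_crossing hM hκ hkh hq
  set F := midPot M κ kh q with hF
  set L := leftPot κ kh q with hL
  set R := rightPot M κ kh q with hR
  have hLnn : ∀ j, j ≤ M → 0 ≤ L j := leftPot_nonneg hκ hkh hq'
  have hRnn : ∀ j, 1 ≤ j → 0 ≤ R j := rightPot_nonneg hκ hkh hq'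
  have hFleL : ∀ j, j ≤ M → F j ≤ L j := by
    intro j hj
    rw [hF, midPot]
    split_ifs
    · exact min_le_left _ _
    · exact hLnn j hj
  have hFleR : ∀ j, 1 ≤ j → F j ≤ R j := by
    intro j hj
    rw [hF, midPot]
    split_ifs
    · exact min_le_right _ _
    · exact hRnn j hj
  let SL : ℕ → ℝ := fun j => ∑ a ∈ Icc 1 j, (q a + kh a * L a)
  let SR : ℕ → ℝ := fun j => ∑ a ∈ Icc j M, (q a + kh a * R a)
  have hmL : ∀ a, 1 ≤ a → a ≤ M → 0 ≤ q a + kh a * L a := fun a h1 h2 =>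
    add_nonneg (hq' a h1 h2) (mul_nonneg (hkh a) (hLnn a h2))
  have hmR : ∀ a, 1 ≤ a → a ≤ M → 0 ≤ q a + kh a * R a := fun a h1 h2 =>
    add_nonneg (hq' a h1 h2) (mul_nonneg (hkh a) (hRnn a h1))
  have hSLmono : ∀ a b, a ≤ b → b ≤ M → SL a ≤ SL b := fun a b hab hb =>
    sum_le_sum_of_subset_of_nonneg (Icc_subset_Icc le_rfl hab) fun i hi _ =>
      hmL i (mem_Icc.1 hi).1 ((mem_Icc.1 hi).2.trans hb)
  have hSRmono : ∀ a b, 1 ≤ a → a ≤ b → SR b ≤ SR a := fun a b ha hab =>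
    sum_le_sum_of_subset_of_nonneg (Icc_subset_Icc hab le_rfl) fun i hi _ =>
      hmR i (ha.trans (mem_Icc.1 hi).1) (mem_Icc.1 hi).2
  have hSLnn : ∀ j, j ≤ M → 0 ≤ SL j := fun j hj => by
    simpa [SL] using hSLmono 0 j (Nat.zero_le _) hj
  have hSRnn : ∀ j, 1 ≤ j → 0 ≤ SR j := fun j hj => sum_nonneg fun i hi =>
    hmR i (hj.trans (mem_Icc.1 hi).1) (mem_Icc.1 hi).2
  have hLs : ∀ j, L (j + 1) = L j + (κ (j + 1) - κ j) * SL j := leftPot_succ κ kh q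
  have hRs : ∀ j, j + 1 ≤ M → R j = R (j + 1) + (κ (j + 1) - κ j) * SR (j + 1) :=
    rightPot_succ M κ kh q
  have hSLs : ∀ j, SL (j + 1) = SL j + (q (j + 1) + kh (j + 1) * L (j + 1)) := fun j =>
    sum_Icc_succ_top (by omega) _
  have hSRs : ∀ j, j ≤ M → SR j = SR (j + 1) + (q j + kh j * R j) := fun j hj => by
    simp only [SR]
    have : Icc j M = insert j (Icc (j + 1) M) := by ext; simp; omega
    rw [this, sum_insert (by simp)]
    ring
  have hLle : ∀ j, 1 ≤ j → j ≤ M → L j ≤ (κ M - κ 1) * SL (j - 1) := by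
    intro j h1 h2
    rw [hL, leftPot_eq, mul_sum]
    refine sum_le_sum fun a ha => ?_
    obtain ⟨h3, h4⟩ := mem_Icc.1 ha
    refine mul_le_mul_of_nonneg_right ?_ (hmL a h3 (by omega))
    linarith [hκle j M h1 h2 le_rfl, hκle 1 a le_rfl h3 (by omega)]
  have hRle : ∀ j, 1 ≤ j → j ≤ M → R j ≤ (κ M - κ 1) * SR (j + 1) := by
    intro j h1 h2
    rw [hR, rightPot_eq, mul_sum]
    refine sum_le_sum fun a ha => ?_
    obtain ⟨h3, h4⟩ := mem_Icc.1 ha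
    refine mul_le_mul_of_nonneg_right ?_ (hmR a (by omega) h4)
    linarith [hκle 1 j le_rfl h1 h2, hκle a M (by omega) h4 le_rfl]
  obtain ⟨l, rfl⟩ : ∃ l', l = l' + 1 := ⟨l - 1, by omega⟩
  simp only [Nat.add_sub_cancel] at hlt
  -- the diagonal entry to the left and to the right of the crossing
  have hAL : ∀ j, 1 ≤ j → j ≤ l → q j + kh j * F j + F j / (κ (j + 1) - κ j) +
      F j / (κ j - κ (j - 1)) = F (j - 1) / (κ j - κ (j - 1)) + L (j + 1) / (κ (j + 1) - κ j) := by
    intro j h1 h2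
    obtain ⟨j, rfl⟩ : ∃ j', j = j' + 1 := ⟨j - 1, by omega⟩
    simp only [Nat.add_sub_cancel]
    have hd := (hΔ (j + 1) h1 (by omega)).ne'
    have e1 : F (j + 1) / (κ (j + 1) - κ j) = F j / (κ (j + 1) - κ j) + SL j := by
      rw [hFL (j + 1) (by omega), hFL j (by omega), hLs j]
      rcases Nat.eq_zero_or_pos j with rfl | hj
      · simp [SL]
      · have := (hΔ j hj (by omega)).ne'
        field_simp
    rw [e1, hLs (j + 1), hFL (j + 1) (by omega), hSLs]
    field_simp
    ring
  have hAR : ∀ j, l + 1 ≤ j → j ≤ M → q j + kh j * F j + F j / (κ (j + 1) - κ j) +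
      F j / (κ j - κ (j - 1)) = F (j + 1) / (κ (j + 1) - κ j) + R (j - 1) / (κ j - κ (j - 1)) := by
    intro j h1 h2
    obtain ⟨j, rfl⟩ : ∃ j', j = j' + 1 := ⟨j - 1, by omega⟩
    simp only [Nat.add_sub_cancel]
    have hd := (hΔ j (by omega) (by omega)).ne'
    have e1 : F (j + 1) / (κ (j + 1 + 1) - κ (j + 1)) =
        F (j + 1 + 1) / (κ (j + 1 + 1) - κ (j + 1)) + SR (j + 1 + 1) := by
      rw [hFR (j + 1) (by omega), hFR (j + 1 + 1) (by omega)]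
      by_cases hj : j + 1 + 1 ≤ M
      · rw [hRs (j + 1) hj]
        have := (hΔ (j + 1) (by omega) hj).ne'
        field_simp
      · have h3 : ∀ i, M ≤ i → R i = 0 := fun i hi => by
          rw [hR, rightPot_eq, Icc_eq_empty (by omega), sum_empty]
        have h4 : SR (j + 1 + 1) = 0 := by
          simp only [SR]
          rw [Icc_eq_empty (by omega), sum_empty]
        rw [h3 _ (by omega), h3 _ (by omega), h4]
        simp
    rw [e1, hRs j h2, hFR (j + 1) (by omega), hSRs (j + 1) h2]
    field_simp
    ring
  -- the total mass, and the masses at the two points next to the crossing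
  set m := SL l + SR (l + 1) with hm
  have hm0 : 0 ≤ m := add_nonneg (hSLnn l (by omega)) (hSRnn _ (by omega))
  have hΔl := hΔ l (by omega) hlM
  have hvv : (L (l + 1) - R (l + 1)) / (κ (l + 1) - κ l) + (R l - L l) / (κ (l + 1) - κ l) = m := by
    rw [hLs l, hRs l hlM]
    field_simp
    ring
  have hqm : ∀ j, 1 ≤ j → j ≤ M → q j ≤ m := by
    intro j h1 h2
    by_cases hj : j ≤ l
    · have h3 := hSLmono j l hj (by omega)
      have h4 : q j + kh j * L j ≤ SL j := single_le_sum (f := fun a => q a + kh a * L a)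
        (fun i hi => hmL i (mem_Icc.1 hi).1 ((mem_Icc.1 hi).2.trans h2)) (mem_Icc.2 ⟨h1, le_rfl⟩)
      linarith [mul_nonneg (hkh j) (hLnn j h2), hSRnn (l + 1) (by omega)]
    · have h3 := hSRmono (l + 1) j (by omega) (by omega)
      have h4 : q j + kh j * R j ≤ SR j := single_le_sum (f := fun a => q a + kh a * R a)
        (fun i hi => hmR i (h1.trans (mem_Icc.1 hi).1) (mem_Icc.1 hi).2) (mem_Icc.2 ⟨le_rfl, h2⟩)
      linarith [mul_nonneg (hkh j) (hRnn j h1), hSLnn l (by omega)]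
  have hFm : ∀ j, 1 ≤ j → j ≤ M → F j ≤ (κ M - κ 1) * m := by
    intro j h1 h2
    have h0 : 0 ≤ κ M - κ 1 := sub_nonneg.2 (hκle 1 M le_rfl (by omega) le_rfl)
    by_cases hj : j ≤ l
    · refine (hFleL j h2).trans ((hLle j h1 h2).trans (mul_le_mul_of_nonneg_left ?_ h0))
      linarith [hSLmono (j - 1) l (by omega) (by omega), hSRnn (l + 1) (by omega)]
    · refine (hFleR j h1).trans ((hRle j h1 h2).trans (mul_le_mul_of_nonneg_left ?_ h0))
      linarith [hSRmono (l + 1) (j + 1) (by omega) (by omega), hSLnn l (by omega)]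
  have hF0 : F 0 = 0 := by simp [hF, midPot]
  have hFM : F (M + 1) = 0 := by
    rw [hF, midPot, if_neg (by omega)]
  have hFm₁ : ∀ j, 1 ≤ j → j ≤ M → F (j - 1) / (κ j - κ (j - 1)) ≤ D * m := by
    intro j h1 h2
    obtain ⟨j, rfl⟩ : ∃ j', j = j' + 1 := ⟨j - 1, by omega⟩
    simp only [Nat.add_sub_cancel]
    rcases Nat.eq_zero_or_pos j with rfl | hj
    · rw [hF0, zero_div]
      positivity
    · rw [div_le_iff₀ (hΔ j hj h2)]
      have := mul_le_mul_of_nonneg_right (hD j hj h2) hm0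
      linarith [hFm j hj (by omega)]
  have hFm₂ : ∀ j, 1 ≤ j → j ≤ M → F (j + 1) / (κ (j + 1) - κ j) ≤ D * m := by
    intro j h1 h2
    by_cases hj : j + 1 ≤ M
    · rw [div_le_iff₀ (hΔ j h1 hj)]
      have := mul_le_mul_of_nonneg_right (hD j h1 hj) hm0
      linarith [hFm (j + 1) (by omega) hj]
    · rw [show j = M by omega, hFM, zero_div]
      positivity
  obtain ⟨c, v, hc1, hcM, hcl, hlc, hAc, hv⟩ : ∃ c v, 1 ≤ c ∧ c ≤ M ∧ c ≤ l + 1 ∧ l ≤ c ∧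
      q c + kh c * F c + F c / (κ (c + 1) - κ c) + F c / (κ c - κ (c - 1)) =
        v + F (c - 1) / (κ c - κ (c - 1)) + F (c + 1) / (κ (c + 1) - κ c) ∧ m / 2 ≤ v := by
    by_cases h : m / 2 ≤ (L (l + 1) - R (l + 1)) / (κ (l + 1) - κ l)
    · refine ⟨l, _, by omega, by omega, by omega, le_rfl, ?_, h⟩
      rw [hAL l (by omega) le_rfl, hFR (l + 1) le_rfl, sub_div]
      ring
    · refine ⟨l + 1, (R l - L l) / (κ (l + 1) - κ l), by omega, hlM, le_rfl, by omega, ?_,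
        by linarith⟩
      rw [hAR (l + 1) le_rfl hlM, Nat.add_sub_cancel, hFL l (by omega), sub_div]
      ring
  refine ⟨centredWeight T K M c, fun j h1 h2 => ⟨centredWeight_nonneg hT0 (by linarith) M c j,
    centredWeight_le hK1 h2 hcM, ?_⟩⟩
  unfold potStep
  rcases lt_trichotomy j c with hjc | rfl | hjc
  · rw [hAL j h1 (by omega)]
    obtain ⟨j, rfl⟩ : ∃ j', j = j' + 1 := ⟨j - 1, by omega⟩
    have hd := hΔ (j + 1) h1 (by omega)
    have e1 := centredWeight_left T K (M := M) hjc
    have e2 := centredWeight_left T K (M := M) (show j < c by omega)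
    have e3 : centredWeight T K M c (j + 1 + 1) =
        centredWeight T K M c (j + 1) - 2 * D * K ^ j := by
      rw [e1, pow_succ, hK]; ring
    simp only [Nat.add_sub_cancel]
    rw [e2, e3]
    have hE : L (j + 1 + 1) / (κ (j + 1 + 1) - κ (j + 1)) =
        L (j + 1) / (κ (j + 1 + 1) - κ (j + 1)) + SL (j + 1) := by
      rw [hLs (j + 1)]
      field_simp
    have hL1 : 0 ≤ L (j + 1) / (κ (j + 1 + 1) - κ (j + 1)) := div_nonneg (hLnn _ h2) hd.le
    have hS1 := hSLs j
    have hS2 := hSLnn j (by omega)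
    have hkL := mul_nonneg (hkh (j + 1)) (hLnn _ h2)
    refine weight_ineq_off_centre hD1 (one_le_pow₀ hK1) ?_ ?_ ?_ ?_ ?_
    · have := centredWeight_nonneg hT0 (by linarith) M c (j + 1 + 1) (K := K)
      linarith
    · linarith
    · linarith [hq' (j + 1) h1 h2]
    · exact div_le_div_of_nonneg_right (hFleL _ (by omega)) hd.le
    · rcases Nat.eq_zero_or_pos j with rfl | hj
      · rw [hF0, zero_div]
        have : 0 ≤ L (0 + 1 + 1) / (κ (0 + 1 + 1) - κ (0 + 1)) :=
          div_nonneg (hLnn _ (by omega)) hd.le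
        positivity
      · rw [div_le_iff₀ (hΔ j hj h2)]
        have h3 : F j ≤ L (j + 1 + 1) := by
          refine (hFleL j (by omega)).trans ?_
          rw [hLs (j + 1), hLs j]
          linarith [mul_nonneg hd.le (hSLnn (j + 1) h2),
            mul_nonneg (hΔ j hj h2).le (hSLnn j (by omega))]
        have h4 : κ (j + 1 + 1) - κ (j + 1) ≤ D * (κ (j + 1) - κ j) := by
          linarith [hD j hj h2, hκle 1 (j + 1) le_rfl h1 h2,
            hκle (j + 1 + 1) M (by omega) (by omega) le_rfl]
        have h5 := mul_le_mul_of_nonneg_left h4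
          (div_nonneg (hLnn (j + 1 + 1) (by omega)) hd.le)
        rw [div_mul_cancel₀ _ hd.ne'] at h5
        linarith
  · rw [hAc, centredWeight_self, centredWeight_right T K le_rfl, centredWeight_self]
    obtain ⟨c, rfl⟩ : ∃ c', j = c' + 1 := ⟨j - 1, by omega⟩
    have e2 := centredWeight_left T K (M := M) (Nat.lt_succ_self c)
    rw [Nat.succ_eq_add_one, centredWeight_self] at e2
    rw [Nat.add_sub_cancel, e2]
    exact weight_ineq_centre hD1 (by positivity) (by positivity)
      (pow_le_pow_right₀ hK1 (by omega)) (pow_le_pow_right₀ hK1 (by omega)) (hqm _ h1 h2) hm0 hv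
      (hFm₁ _ h1 h2) (hFm₂ _ h1 h2)
  · rw [hAR j (by omega) h2]
    obtain ⟨j, rfl⟩ : ∃ j', j = j' + 1 := ⟨j - 1, by omega⟩
    have hd := hΔ j (by omega) h2
    have e1 := centredWeight_right T K (M := M) (show c ≤ j by omega)
    have e2 := centredWeight_right T K (M := M) hjc.le
    have e3 : centredWeight T K M c j =
        centredWeight T K M c (j + 1) - 2 * D * K ^ (M - (j + 1)) := by
      rw [e1, show M - j = M - (j + 1) + 1 by omega, pow_succ, hK]; ring
    simp only [Nat.add_sub_cancel]
    rw [e2, e3, sub_right_comm]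
    have hE : R j / (κ (j + 1) - κ j) = R (j + 1) / (κ (j + 1) - κ j) + SR (j + 1) := by
      rw [hRs j h2]
      field_simp
    have hR1 : 0 ≤ R (j + 1) / (κ (j + 1) - κ j) := div_nonneg (hRnn _ h1) hd.le
    have hS1 := hSRs (j + 1) h2
    have hS2 := hSRnn (j + 1 + 1) (by omega)
    have hkR := mul_nonneg (hkh (j + 1)) (hRnn _ h1)
    refine weight_ineq_off_centre hD1 (one_le_pow₀ hK1) ?_ ?_ ?_ ?_ ?_
    · have := centredWeight_nonneg hT0 (by linarith) M c j (K := K)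
      linarith
    · linarith
    · linarith [hq' (j + 1) h1 h2]
    · exact div_le_div_of_nonneg_right (hFleR _ (by omega)) hd.le
    · by_cases hj : j + 1 + 1 ≤ M
      · have hd' := hΔ (j + 1) h1 hj
        rw [div_le_iff₀ hd']
        have h3 : F (j + 1 + 1) ≤ R j := by
          refine (hFleR (j + 1 + 1) (by omega)).trans ?_
          rw [hRs j h2, hRs (j + 1) hj]
          linarith [mul_nonneg hd.le (hSRnn (j + 1) h1), mul_nonneg hd'.le hS2]
        have h4 : κ (j + 1) - κ j ≤ D * (κ (j + 1 + 1) - κ (j + 1)) := by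
          linarith [hD (j + 1) h1 hj, hκle 1 j le_rfl (by omega) (by omega),
            hκle (j + 1) M (by omega) (by omega) le_rfl]
        have h5 := mul_le_mul_of_nonneg_left h4 (div_nonneg (hRnn j (by omega)) hd.le)
        rw [div_mul_cancel₀ _ hd.ne'] at h5
        linarith
      · rw [show j + 1 + 1 = M + 1 by omega, hFM, zero_div]
        have := div_nonneg (hRnn j (by omega)) hd.le
        positivity

/-- The harmonic width `(κ_{j+1} - κ_j)(κ_j - κ_{j-1}) / (κ_{j+1} - κ_{j-1})`. -/
def gridWidth (κ : ℕ → ℝ) (j : ℕ) : ℝ :=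
  (κ (j + 1) - κ j) * (κ j - κ (j - 1)) / (κ (j + 1) - κ (j - 1))

/-- The intensity with which mass `q` produces the potential `midPot` in time `s`. -/
def potIntensity (M : ℕ) (s : ℝ) (κ kh q : ℕ → ℝ) (j : ℕ) : ℝ :=
  midPot M κ kh q j / (s * gridWidth κ j * q j)

lemma grid_gaps {M : ℕ} {κ : ℕ → ℝ} (hκ : StrictMonoOn κ (Set.Icc 1 M)) {j : ℕ} (h2 : 2 ≤ j)
    (hj : j ≤ M - 1) : 0 < κ (j + 1) - κ j ∧ 0 < κ j - κ (j - 1) :=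
  ⟨sub_pos.2 (hκ ⟨by omega, by omega⟩ ⟨by omega, by omega⟩ (by omega)),
    sub_pos.2 (hκ ⟨by omega, by omega⟩ ⟨by omega, by omega⟩ (by omega))⟩

lemma gridWidth_pos {M : ℕ} {κ : ℕ → ℝ} (hκ : StrictMonoOn κ (Set.Icc 1 M)) {j : ℕ} (h2 : 2 ≤ j)
    (hj : j ≤ M - 1) : 0 < gridWidth κ j := by
  obtain ⟨h3, h4⟩ := grid_gaps hκ h2 hj
  exact div_pos (mul_pos h3 h4) (by linarith)

lemma midPot_eq_zero {M : ℕ} {j : ℕ} (hj : ¬(2 ≤ j ∧ j ≤ M - 1)) (κ kh q : ℕ → ℝ) :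
    midPot M κ kh q j = 0 := if_neg hj

lemma potIntensity_eq_zero {M : ℕ} {j : ℕ} (hj : ¬(2 ≤ j ∧ j ≤ M - 1)) (s : ℝ) (κ kh q : ℕ → ℝ) :
    potIntensity M s κ kh q j = 0 := by
  rw [potIntensity, midPot_eq_zero hj, zero_div]

lemma potIntensity_pos {M : ℕ} {κ kh q : ℕ → ℝ} (hκ : StrictMonoOn κ (Set.Icc 1 M))
    (hkh : ∀ a, 0 ≤ kh a) (hq : ∀ a, 1 ≤ a → a ≤ M → 0 < q a) {s : ℝ} (hs : 0 < s) {j : ℕ}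
    (h2 : 2 ≤ j) (hj : j ≤ M - 1) : 0 < potIntensity M s κ kh q j :=
  div_pos (midPot_pos hκ hkh hq j h2 hj)
    (mul_pos (mul_pos hs (gridWidth_pos hκ h2 hj)) (hq j (by omega) (by omega)))

lemma mul_potIntensity_mul {M : ℕ} {κ q : ℕ → ℝ}
    (hq : ∀ a, 1 ≤ a → a ≤ M → 0 < q a) {s : ℝ} (hs : 0 < s) (kh : ℕ → ℝ) (j : ℕ) :
    s * potIntensity M s κ kh q j * q j = midPot M κ kh q j / gridWidth κ j := by
  by_cases hj : 2 ≤ j ∧ j ≤ M - 1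
  · have h1 := (hq j (by omega) (by omega)).ne'
    rw [potIntensity]
    have := hs.ne'
    field_simp
  · rw [potIntensity_eq_zero hj, midPot_eq_zero hj]
    simp

lemma mass_eq {M : ℕ} {κ kt q : ℕ → ℝ}
    (hq : ∀ a, 1 ≤ a → a ≤ M → 0 < q a) {s : ℝ} (hs : 0 < s) (kh : ℕ → ℝ)
    (hkt : ∀ a, kh a = kt a / gridWidth κ a) (a : ℕ) :
    q a * (1 + s * potIntensity M s κ kh q a * kt a) = q a + kh a * midPot M κ kh q a := by
  have h1 : q a * (1 + s * potIntensity M s κ kh q a * kt a) =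
      q a + s * potIntensity M s κ kh q a * q a * kt a := by ring
  rw [h1, mul_potIntensity_mul hq hs, hkt a]
  ring

/-- The intensities built from the potential solve the G-system. -/
lemma exists_GSystem_potIntensity {M : ℕ} (hM : 3 ≤ M) {κ kh kt q P : ℕ → ℝ}
    (hκ : StrictMonoOn κ (Set.Icc 1 M)) (hkh : ∀ a, 0 ≤ kh a)
    (hkt : ∀ a, kh a = kt a / gridWidth κ a) (hq : ∀ a, 1 ≤ a → a ≤ M → 0 < q a) {s W : ℝ}
    (hs : 0 < s) (hW : 0 < W) (hP : ∀ a, 1 ≤ a → a ≤ M → P a = q a / W) :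
    ∃ l, GSystem M s κ kt P (potIntensity M s κ kh q) l := by
  obtain ⟨l, hl2, hlM, hFL, hFR, hlt, hge⟩ := exists_crossing hM hκ hkh hq
  have hm := mass_eq (κ := κ) hq hs kh hkt
  set G := potIntensity M s κ kh q with hG
  set F := midPot M κ kh q with hF
  have hG0 : ∀ j, ¬(2 ≤ j ∧ j ≤ M - 1) → G j = 0 := fun j hj => potIntensity_eq_zero hj s κ kh q
  have hPm : ∀ a, 1 ≤ a → a ≤ M → P a * (1 + s * G a * kt a) = (q a + kh a * F a) / W := by
    intro a h1 h2
    rw [hP a h1 h2, ← hm a]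
    ring
  have hFnn : ∀ a, 0 ≤ F a := by
    intro a
    by_cases ha : 2 ≤ a ∧ a ≤ M - 1
    · exact (midPot_pos hκ hkh hq a ha.1 ha.2).le
    · rw [hF, midPot_eq_zero ha]
  have hmpos : ∀ a ∈ Icc 1 M, 0 < q a + kh a * F a := fun a ha =>
    add_pos_of_pos_of_nonneg (hq a (mem_Icc.1 ha).1 (mem_Icc.1 ha).2) (mul_nonneg (hkh a) (hFnn a))
  have hden : 0 < ∑ a ∈ Icc 1 M, (q a + kh a * F a) :=
    sum_pos hmpos ⟨1, mem_Icc.2 (by omega)⟩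
  have hx0 : Gx0 M s κ kt P G =
      (∑ a ∈ Icc 1 M, κ a * (q a + kh a * F a)) / ∑ a ∈ Icc 1 M, (q a + kh a * F a) := by
    have h1 : ∑ j ∈ Icc 1 M, κ j * P j * (1 + s * G j * kt j) =
        (∑ a ∈ Icc 1 M, κ a * (q a + kh a * F a)) / W := by
      rw [sum_div]
      refine sum_congr rfl fun a ha => ?_
      rw [mul_assoc, hPm a (mem_Icc.1 ha).1 (mem_Icc.1 ha).2, mul_div_assoc]
    have h2 : ∑ j ∈ Icc 1 M, P j * (1 + s * G j * kt j) =
        (∑ a ∈ Icc 1 M, (q a + kh a * F a)) / W := by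
      rw [sum_div]
      exact sum_congr rfl fun a ha => hPm a (mem_Icc.1 ha).1 (mem_Icc.1 ha).2
    rw [Gx0, h1, h2, div_div_div_cancel_right₀ hW.ne']
  have hLe : ∀ j, j ≤ l → leftPot κ kh q j =
      ∑ a ∈ Icc 1 (j - 1), (κ j - κ a) * (q a + kh a * F a) := by
    intro j hj
    rw [leftPot_eq]
    refine sum_congr rfl fun a ha => ?_
    rw [hFL a (by have := mem_Icc.1 ha; omega)]
  have hRe : ∀ j, l ≤ j + 1 → rightPot M κ kh q j =
      ∑ a ∈ Icc (j + 1) M, (κ a - κ j) * (q a + kh a * F a) := by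
    intro j hj
    rw [rightPot_eq]
    refine sum_congr rfl fun a ha => ?_
    rw [hFR a (by have := mem_Icc.1 ha; omega)]
  have hdiff : ∀ j, 1 ≤ j → j ≤ M → j ≤ l → l ≤ j + 1 →
      rightPot M κ kh q j - leftPot κ kh q j =
        ∑ a ∈ Icc 1 M, κ a * (q a + kh a * F a) - κ j * ∑ a ∈ Icc 1 M, (q a + kh a * F a) := by
    intro j h1 h2 h3 h4
    have h5 : Icc 1 M = Icc 1 (j - 1) ∪ insert j (Icc (j + 1) M) := by
      ext a
      simp only [mem_Icc, mem_union, mem_insert]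
      omega
    have h6 : Disjoint (Icc 1 (j - 1)) (insert j (Icc (j + 1) M)) := by
      rw [disjoint_left]
      intro a ha
      simp only [mem_Icc, mem_insert] at ha ⊢
      omega
    rw [hLe j h3, hRe j h4, mul_sum, ← sum_sub_distrib, h5, sum_union h6, sum_insert (by simp),
      sub_self, zero_add, sub_eq_add_neg, ← sum_neg_distrib, add_comm]
    congr 1
    · exact sum_congr rfl fun a _ => by ring
    · exact sum_congr rfl fun a _ => by ring
  have hGj : ∀ j, 2 ≤ j → j ≤ M - 1 → G j = (1 / (s * P j)) *
      ((κ (j + 1) - κ (j - 1)) / ((κ (j + 1) - κ j) * (κ j - κ (j - 1)))) * (F j / W) := by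
    intro j h1 h2
    obtain ⟨h3, h4⟩ := grid_gaps hκ h1 h2
    have h5 : κ (j + 1) - κ (j - 1) ≠ 0 := by linarith
    have h6 := hq j (by omega) (by omega)
    rw [hG, potIntensity, hP j (by omega) (by omega), gridWidth, ← hF]
    field_simp
  refine ⟨l, hl2, hlM, fun j _ _ => ?_, hG0 1 (by omega), hG0 M (by omega), ?_, ?_, ?_, ?_⟩
  · by_cases hj : 2 ≤ j ∧ j ≤ M - 1
    · exact (potIntensity_pos hκ hkh hq hs hj.1 hj.2).le
    · rw [hG0 j hj]
  · rw [hx0, lt_div_iff₀ hden]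
    have := hdiff (l - 1) (by omega) (by omega) (by omega) (by omega)
    linarith
  · rw [hx0, div_le_iff₀ hden]
    have := hdiff l (by omega) (by omega) (by omega) (by omega)
    linarith
  · intro j h1 h2
    rw [hGj j h1 (by omega), hFL j (by omega), hLe j (by omega), sum_div]
    congr 1
    refine sum_congr rfl fun a ha => ?_
    obtain ⟨h3, h4⟩ := mem_Icc.1 ha
    rw [mul_assoc, hPm a h3 (by omega), mul_div_assoc]
  · intro j h1 h2
    rw [hGj j (by omega) h2, hFR j (by omega), hRe j (by omega), sum_div]
    congr 1
    refine sum_congr rfl fun a ha => ?_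
    obtain ⟨h3, h4⟩ := mem_Icc.1 ha
    rw [mul_assoc, hPm a (by omega) h4, mul_div_assoc]

lemma sum_fin_add_one_eq_sum_Icc (f : ℕ → ℝ) (M : ℕ) :
    ∑ u : Fin M, f (u.1 + 1) = ∑ a ∈ Icc 1 M, f a := by
  induction M with
  | zero => simp
  | succ n ih =>
    rw [Fin.sum_univ_castSucc, sum_Icc_succ_top (by omega), ← ih]
    simp

lemma sum_mul_NtE_col {M : ℕ} {s : ℝ} {i b k lam : ℕ → ℝ}
    (hlam : ∀ j, ¬(2 ≤ j ∧ j ≤ M - 1) → lam j = 0) (x : ℕ → ℝ) {c : ℕ} (h1 : 1 ≤ c) (hc : c ≤ M) :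
    ∑ a ∈ Icc 1 M, x a * NtE M s i b k lam a c =
      x c * (1 + s * lam c * (1 + ktil M i k c)) -
        x (c - 1) * (s * lam (c - 1) * qup i b (c - 1)) -
        x (c + 1) * (s * lam (c + 1) * qdn i b (c + 1)) := by
  have hent : ∀ a ∈ Icc 1 M, x a * NtE M s i b k lam a c =
      (if a = c then x a * (1 + s * lam a * (1 + ktil M i k a)) else 0) -
        (if a = c - 1 then x a * (s * lam a * qup i b a) else 0) -
        (if a = c + 1 then x a * (s * lam a * qdn i b a) else 0) := by
    intro a ha
    obtain ⟨h3, h4⟩ := mem_Icc.1 ha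
    unfold NtE
    by_cases hj : 2 ≤ a ∧ a ≤ M - 1
    · rw [if_pos hj]
      by_cases e1 : c = a
      · rw [if_pos e1, if_pos e1.symm, if_neg (by omega), if_neg (by omega)]
        ring
      rw [if_neg e1, if_neg (Ne.symm e1)]
      by_cases e2 : c = a + 1
      · rw [if_pos e2, if_pos (by omega), if_neg (by omega)]
        ring
      rw [if_neg e2, if_neg (show ¬ a = c - 1 by omega)]
      by_cases e3 : c = a - 1
      · rw [if_pos e3, if_pos (by omega)]
        ring
      rw [if_neg e3, if_neg (by omega), if_neg (by omega)]
      ring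
    · rw [if_neg hj, hlam a hj]
      by_cases e1 : c = a
      · rw [if_pos e1, if_pos e1.symm]
        simp
      · rw [if_neg e1, if_neg (Ne.symm e1)]
        simp
  rw [sum_congr rfl hent, sum_sub_distrib, sum_sub_distrib, sum_ite_eq', sum_ite_eq', sum_ite_eq',
    if_pos (mem_Icc.2 ⟨h1, hc⟩)]
  congr 1
  · congr 1
    split_ifs with h
    · rfl
    · rw [hlam (c - 1) (by rw [mem_Icc] at h; omega)]
      simp
  · split_ifs with h
    · rfl
    · rw [hlam (c + 1) (by rw [mem_Icc] at h; omega)]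
      simp

lemma sum_NtE_mul_row {M : ℕ} {s : ℝ} {i b k lam : ℕ → ℝ}
    (hlam : ∀ j, ¬(2 ≤ j ∧ j ≤ M - 1) → lam j = 0) (h : ℕ → ℝ) {a : ℕ} (h1 : 1 ≤ a) (ha : a ≤ M) :
    ∑ c ∈ Icc 1 M, NtE M s i b k lam a c * h c =
      h a + s * lam a * ((1 + ktil M i k a) * h a - qup i b a * h (a + 1) -
        qdn i b a * h (a - 1)) := by
  by_cases hj : 2 ≤ a ∧ a ≤ M - 1
  · have hent : ∀ c ∈ Icc 1 M, NtE M s i b k lam a c * h c =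
        (if c = a then (1 + s * lam a * (1 + ktil M i k a)) * h c else 0) -
          (if c = a + 1 then s * lam a * qup i b a * h c else 0) -
          (if c = a - 1 then s * lam a * qdn i b a * h c else 0) := by
      intro c hc
      obtain ⟨h3, h4⟩ := mem_Icc.1 hc
      unfold NtE
      rw [if_pos hj]
      by_cases e1 : c = a
      · rw [if_pos e1, if_pos e1, if_neg (by omega), if_neg (by omega)]
        ring
      rw [if_neg e1, if_neg e1]
      by_cases e2 : c = a + 1
      · rw [if_pos e2, if_pos e2, if_neg (by omega)]
        ring
      rw [if_neg e2, if_neg e2]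
      by_cases e3 : c = a - 1
      · rw [if_pos e3, if_pos e3]
        ring
      rw [if_neg e3, if_neg e3, if_neg (by omega)]
      ring
    rw [sum_congr rfl hent, sum_sub_distrib, sum_sub_distrib, sum_ite_eq', sum_ite_eq',
      sum_ite_eq', if_pos (mem_Icc.2 ⟨h1, ha⟩), if_pos (mem_Icc.2 (by omega)),
      if_pos (mem_Icc.2 (by omega))]
    ring
  · have hent : ∀ c ∈ Icc 1 M, NtE M s i b k lam a c * h c = if c = a then h c else 0 := by
      intro c _
      unfold NtE
      rw [if_neg hj]
      split_ifs <;> simp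
    rw [sum_congr rfl hent, sum_ite_eq', if_pos (mem_Icc.2 ⟨h1, ha⟩), hlam a hj]
    ring

/-- Columns of the matrix with potential intensities act on `τ * q` as `potStep`. -/
lemma sum_mul_NtE_eq_potStep {M : ℕ} {s : ℝ} (hs : 0 < s) {i b k κ kh q : ℕ → ℝ}
    (hκ : StrictMonoOn κ (Set.Icc 1 M)) (hm : MartCoord M i b κ)
    (hkt : ∀ a, kh a = ktil M i k a / gridWidth κ a) (hq : ∀ a, 1 ≤ a → a ≤ M → 0 < q a)
    (τ : ℕ → ℝ) {c : ℕ} (h1 : 1 ≤ c) (hc : c ≤ M) :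
    ∑ a ∈ Icc 1 M, τ a * q a * NtE M s i b k (potIntensity M s κ kh q) a c =
      potStep κ kh q (midPot M κ kh q) τ c := by
  rw [sum_mul_NtE_col (fun j hj => potIntensity_eq_zero hj s κ kh q) (fun a => τ a * q a) h1 hc]
  set F := midPot M κ kh q with hF
  have hlq := mul_potIntensity_mul (κ := κ) hq hs kh
  rw [← hF] at hlq
  have hdiag : ∀ j, F j / gridWidth κ j = F j / (κ (j + 1) - κ j) + F j / (κ j - κ (j - 1)) := by
    intro j
    by_cases hj : 2 ≤ j ∧ j ≤ M - 1
    · obtain ⟨h3, h4⟩ := grid_gaps hκ hj.1 hj.2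
      have h5 : κ (j + 1) - κ (j - 1) ≠ 0 := by linarith
      rw [gridWidth]
      field_simp
      ring
    · rw [hF, midPot_eq_zero hj]
      simp
  have hup : ∀ j, F j / gridWidth κ j * qup i b j = F j / (κ (j + 1) - κ j) := by
    intro j
    by_cases hj : 2 ≤ j ∧ j ≤ M - 1
    · obtain ⟨h3, h4⟩ := grid_gaps hκ hj.1 hj.2
      have h5 : κ (j + 1) - κ (j - 1) ≠ 0 := by linarith
      rw [gridWidth, (hm.2 j hj.1 hj.2).1]
      field_simp
    · rw [hF, midPot_eq_zero hj]
      simp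
  have hdn : ∀ j, F j / gridWidth κ j * qdn i b j = F j / (κ j - κ (j - 1)) := by
    intro j
    by_cases hj : 2 ≤ j ∧ j ≤ M - 1
    · obtain ⟨h3, h4⟩ := grid_gaps hκ hj.1 hj.2
      have h5 : κ (j + 1) - κ (j - 1) ≠ 0 := by linarith
      rw [gridWidth, (hm.2 j hj.1 hj.2).2]
      field_simp
    · rw [hF, midPot_eq_zero hj]
      simp
  obtain ⟨c, rfl⟩ : ∃ c', c = c' + 1 := ⟨c - 1, by omega⟩
  have e0 : kh (c + 1) * F (c + 1) = F (c + 1) / gridWidth κ (c + 1) * ktil M i k (c + 1) := by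
    rw [hkt]
    ring
  have e1 := hdiag (c + 1)
  have e2 := hup c
  have e3 := hdn (c + 1 + 1)
  rw [← hlq] at e0 e1 e2 e3
  simp only [Nat.add_sub_cancel] at e1 e2 e3 ⊢
  rw [potStep, e0, add_assoc _ (_ / _) (_ / _), Nat.add_sub_cancel, ← e1, ← e2, ← e3]
  ring

/-- The positive vector fixed by every matrix `N_s(λ)`. -/
lemma exists_pos_harmonic {M : ℕ} {i b k κ : ℕ → ℝ}
    (hκ : StrictMonoOn κ (Set.Icc 1 M)) (hm : MartCoord M i b κ)
    (hkt : ∀ a, 0 ≤ ktil M i k a / gridWidth κ a) :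
    ∃ h : ℕ → ℝ, (∀ j, 1 ≤ j → j ≤ M → 0 < h j) ∧ ∀ j, 2 ≤ j → j ≤ M - 1 →
      (1 + ktil M i k j) * h j - qup i b j * h (j + 1) - qdn i b j * h (j - 1) = 0 := by
  set kh : ℕ → ℝ := fun a => ktil M i k a / gridWidth κ a with hkh
  refine ⟨fun j => 1 + leftPot κ kh kh j, fun j _ hj => ?_, fun j h2 hj => ?_⟩
  · have := leftPot_nonneg hκ hkt (q := kh) (fun a _ _ => hkt a) j hj
    linarith
  · obtain ⟨h3, h4⟩ := grid_gaps hκ h2 hj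
    have h5 : κ (j + 1) - κ (j - 1) ≠ 0 := by linarith
    have hd := gridWidth_pos hκ h2 hj
    have e0 : ktil M i k j = kh j * gridWidth κ j := (div_mul_cancel₀ _ hd.ne').symm
    have e1 := leftPot_succ κ kh kh j
    have e2 := leftPot_succ κ kh kh (j - 1)
    obtain ⟨j, rfl⟩ : ∃ j', j = j' + 1 := ⟨j - 1, by omega⟩
    rw [sum_Icc_succ_top (by omega)] at e1
    simp only [Nat.add_sub_cancel] at *
    rw [(hm.2 _ h2 hj).1, (hm.2 _ h2 hj).2, e0, gridWidth]
    simp only [Nat.add_sub_cancel]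
    rw [e1, e2]
    field_simp
    ring

/-- A matrix with nonpositive off-diagonal entries fixing a positive vector is monotone. -/
lemma nonneg_of_vecMul_nonneg {I : Type*} [Fintype I] {A : Matrix I I ℝ} {h : I → ℝ}
    (hh : ∀ i, 0 < h i) (hoff : ∀ u v, u ≠ v → A u v ≤ 0) (hAh : A.mulVec h = h) {x : I → ℝ}
    (hx : ∀ v, 0 ≤ (Matrix.vecMul x A) v) (u : I) : 0 ≤ x u := by
  classical
  by_contra! hu
  set S : Finset I := univ.filter fun v => x v < 0 with hS
  have h1 : 0 ≤ ∑ v ∈ S, (Matrix.vecMul x A) v * h v :=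
    sum_nonneg fun v _ => mul_nonneg (hx v) (hh v).le
  have h2 : ∑ v ∈ S, (Matrix.vecMul x A) v * h v = ∑ w, x w * ∑ v ∈ S, A w v * h v := by
    simp only [Matrix.vecMul, dotProduct, sum_mul, mul_sum]
    rw [sum_comm]
    simp only [mul_assoc]
  have h3 : ∀ w, x w < 0 → h w ≤ ∑ v ∈ S, A w v * h v := by
    intro w hw
    have h4 : ∑ v, A w v * h v = h w := congrFun hAh w
    rw [← h4, ← sum_filter_add_sum_filter_not univ (fun v => x v < 0), ← hS]
    refine add_le_of_nonpos_right (sum_nonpos fun v hv => ?_)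
    refine mul_nonpos_of_nonpos_of_nonneg (hoff w v ?_) (hh v).le
    rintro rfl
    exact (mem_filter.1 hv).2 hw
  have h4 : ∀ w, x w * ∑ v ∈ S, A w v * h v ≤ 0 := by
    intro w
    rcases lt_or_ge (x w) 0 with hw | hw
    · exact mul_nonpos_of_nonpos_of_nonneg hw.le ((hh w).le.trans (h3 w hw))
    · refine mul_nonpos_of_nonneg_of_nonpos hw (sum_nonpos fun v hv => ?_)
      refine mul_nonpos_of_nonpos_of_nonneg (hoff w v ?_) (hh v).le
      rintro rfl
      exact absurd (mem_filter.1 hv).2 (not_lt.2 hw)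
  have h5 : ∑ w, x w * ∑ v ∈ S, A w v * h v < 0 :=
    sum_neg' (fun w _ => h4 w) ⟨u, mem_univ u,
      mul_neg_of_neg_of_pos hu ((hh u).trans_le (h3 u hu))⟩
  linarith

lemma isUnit_of_mulVec_eq_self {I : Type*} [Fintype I] [DecidableEq I] {A : Matrix I I ℝ}
    {h : I → ℝ} (hh : ∀ i, 0 < h i) (hoff : ∀ u v, u ≠ v → A u v ≤ 0)
    (hAh : A.mulVec h = h) : IsUnit A := by
  rw [← Matrix.vecMul_injective_iff_isUnit]
  intro x y hxy
  simp only at hxy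
  funext v
  refine le_antisymm (sub_nonneg.1 ?_) (sub_nonneg.1 ?_)
  · refine nonneg_of_vecMul_nonneg hh hoff hAh (x := y - x) (fun w => ?_) v
    rw [Matrix.sub_vecMul, hxy, sub_self, Pi.zero_apply]
  · refine nonneg_of_vecMul_nonneg hh hoff hAh (x := x - y) (fun w => ?_) v
    rw [Matrix.sub_vecMul, hxy, sub_self, Pi.zero_apply]

lemma vecMul_inv_pow_nonneg {I : Type*} [Fintype I] [DecidableEq I] {A : Matrix I I ℝ}
    {h : I → ℝ} (hh : ∀ i, 0 < h i) (hoff : ∀ u v, u ≠ v → A u v ≤ 0)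
    (hAh : A.mulVec h = h) (n : ℕ) {x : I → ℝ} (hx : ∀ v, 0 ≤ x v) (v : I) :
    0 ≤ Matrix.vecMul x (A⁻¹ ^ n) v := by
  induction n generalizing v with
  | zero => simpa using hx v
  | succ n ih =>
    have hA := (Matrix.isUnit_iff_isUnit_det A).1 (isUnit_of_mulVec_eq_self hh hoff hAh)
    refine nonneg_of_vecMul_nonneg hh hoff hAh (fun w => ?_) v
    rw [Matrix.vecMul_vecMul, pow_succ, mul_assoc, Matrix.nonsing_inv_mul A hA, mul_one]
    exact ih w

lemma vecMul_inv_pow_le {I : Type*} [Fintype I] [DecidableEq I] {A : Matrix I I ℝ}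
    {h : I → ℝ} (hh : ∀ i, 0 < h i) (hoff : ∀ u v, u ≠ v → A u v ≤ 0)
    (hAh : A.mulVec h = h) {C : ℝ} (hC : 0 ≤ C) {q ψ : I → ℝ} (hψ : ∀ v, ψ v ≤ C * q v)
    (hqψ : ∀ v, q v ≤ Matrix.vecMul ψ A v) (n : ℕ) (v : I) :
    Matrix.vecMul q (A⁻¹ ^ n) v ≤ C ^ n * q v := by
  have hA := (Matrix.isUnit_iff_isUnit_det A).1 (isUnit_of_mulVec_eq_self hh hoff hAh)
  have hstep : ∀ v, Matrix.vecMul q A⁻¹ v ≤ C * q v := by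
    intro v
    refine le_trans ?_ (hψ v)
    have := nonneg_of_vecMul_nonneg hh hoff hAh (x := ψ - Matrix.vecMul q A⁻¹) (fun w => ?_) v
    · exact sub_nonneg.1 this
    · rw [Matrix.sub_vecMul, Matrix.vecMul_vecMul, Matrix.nonsing_inv_mul A hA, Matrix.vecMul_one]
      exact sub_nonneg.2 (hqψ w)
  induction n generalizing v with
  | zero => simp
  | succ n ih =>
    have h1 := vecMul_inv_pow_nonneg hh hoff hAh n
      (x := fun w => C * q w - Matrix.vecMul q A⁻¹ w) (fun w => sub_nonneg.2 (hstep w)) v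
    have h2 : (fun w => C * q w - Matrix.vecMul q A⁻¹ w) = C • q - Matrix.vecMul q A⁻¹ := rfl
    rw [h2, Matrix.sub_vecMul, Matrix.smul_vecMul, Matrix.vecMul_vecMul, ← pow_succ'] at h1
    have h3 := mul_le_mul_of_nonneg_left (ih v) hC
    simp only [Pi.sub_apply, Pi.smul_apply, smul_eq_mul] at h1
    rw [pow_succ' C]
    linarith

lemma vecMul_inv_pow_dotProduct {I : Type*} [Fintype I] [DecidableEq I] {A : Matrix I I ℝ}
    {h : I → ℝ} (hA : IsUnit A) (hAh : A.mulVec h = h) (n : ℕ) (q : I → ℝ) :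
    dotProduct (Matrix.vecMul q (A⁻¹ ^ n)) h = dotProduct q h := by
  have hA := (Matrix.isUnit_iff_isUnit_det A).1 hA
  have h1 : A⁻¹.mulVec h = h := by
    conv_lhs => rw [← hAh]
    rw [Matrix.mulVec_mulVec, Matrix.nonsing_inv_mul A hA, Matrix.one_mulVec]
  have h2 : (A⁻¹ ^ n).mulVec h = h := by
    induction n with
    | zero => simp
    | succ n ih => rw [pow_succ, ← Matrix.mulVec_mulVec, h1, ih]
  rw [← Matrix.dotProduct_mulVec, h2]

/-- A family of monotone matrices `A q` with uniform relative bounds on `q * (A q)⁻¹` admits a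
fixed point of `q ↦ p * (A q) ^ n`. -/
theorem exists_pos_vecMul_pow_eq {I : Type*} [Fintype I] [DecidableEq I] [Nontrivial I]
    (A : (I → ℝ) → Matrix I I ℝ) {h p : I → ℝ} (hh : ∀ i, 0 < h i) (hp : ∀ i, 0 < p i)
    (hA : ∀ u v, ContinuousOn (fun q => A q u v) {q | ∀ i, 0 < q i})
    (hoff : ∀ q, (∀ i, 0 < q i) → ∀ u v, u ≠ v → A q u v ≤ 0)
    (hAh : ∀ q, (∀ i, 0 < q i) → (A q).mulVec h = h) {C : ℝ} (hC : 0 ≤ C)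
    (hψ : ∀ q, (∀ i, 0 < q i) → ∃ ψ : I → ℝ, (∀ v, ψ v ≤ C * q v) ∧
      ∀ v, q v ≤ Matrix.vecMul ψ (A q) v) (n : ℕ) :
    ∃ q, (∀ i, 0 < q i) ∧ q = Matrix.vecMul p (A q ^ n) := by
  set H := dotProduct p h with hH
  have hH0 : 0 < H := sum_pos (fun i _ => mul_pos (hp i) (hh i)) univ_nonempty
  set ε : ℝ := 1 / (1 + C ^ n) with hε
  have hCn : 0 ≤ C ^ n := by positivity
  have hε0 : 0 < ε := by positivity
  have hε1 : 0 ≤ 1 - ε := by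
    rw [sub_nonneg, hε, div_le_one (by positivity)]
    linarith
  have hCε : C ^ n * ε ≤ 1 := by
    rw [hε, mul_one_div, div_le_one (by positivity)]
    linarith
  let Q : (I → ℝ) → I → ℝ := fun y v => ε * p v + (1 - ε) * (H * y v / h v)
  have hQpos : ∀ y ∈ stdSimplex ℝ I, ∀ v, 0 < Q y v := by
    intro y hy v
    have h1 := hy.1 v
    have h2 := hp v
    have h3 := hh v
    have : 0 ≤ (1 - ε) * (H * y v / h v) := by positivity
    have : 0 < ε * p v := by positivity
    simp only [Q]
    linarith
  have hQc : Continuous Q := by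
    refine continuous_pi fun v => ?_
    fun_prop
  have hQh : ∀ y ∈ stdSimplex ℝ I, dotProduct (Q y) h = H := by
    intro y hy
    have h1 : dotProduct (Q y) h = ∑ v, (ε * (p v * h v) + (1 - ε) * H * y v) := by
      refine sum_congr rfl fun v _ => ?_
      have := (hh v).ne'
      simp only [Q]
      field_simp
    rw [h1, sum_add_distrib, ← mul_sum, ← mul_sum, hy.2]
    change ε * H + _ = H
    ring
  let U : (I → ℝ) → I → ℝ := fun y => Matrix.vecMul (Q y) ((A (Q y))⁻¹ ^ n)
  have hunit : ∀ y ∈ stdSimplex ℝ I, IsUnit (A (Q y)) := fun y hy =>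
    isUnit_of_mulVec_eq_self hh (hoff _ (hQpos y hy)) (hAh _ (hQpos y hy))
  have hUh : ∀ y ∈ stdSimplex ℝ I, dotProduct (U y) h = H := fun y hy => by
    rw [← hQh y hy]
    exact vecMul_inv_pow_dotProduct (hunit y hy) (hAh _ (hQpos y hy)) n (Q y)
  have hUc : ContinuousOn U (stdSimplex ℝ I) := by
    have h1 : ContinuousOn (fun y => A (Q y)) (stdSimplex ℝ I) := by
      refine continuousOn_pi.2 fun u => continuousOn_pi.2 fun v => ?_
      exact (hA u v).comp hQc.continuousOn hQpos
    have h2 : ContinuousOn (fun y => (A (Q y))⁻¹) (stdSimplex ℝ I) := by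
      intro y hy
      refine ContinuousAt.comp_continuousWithinAt (g := fun B : Matrix I I ℝ => B⁻¹) ?_ (h1 y hy)
      refine continuousAt_matrix_inv _ ?_
      have := (Matrix.isUnit_iff_isUnit_det _).1 (hunit y hy)
      rw [Ring.inverse_eq_inv']
      exact continuousAt_inv₀ this.ne_zero
    have h3 : Continuous fun z : (I → ℝ) × Matrix I I ℝ => Matrix.vecMul z.1 (z.2 ^ n) :=
      continuous_fst.matrix_vecMul (continuous_snd.pow n)
    exact h3.comp_continuousOn (hQc.continuousOn.prodMk h2)
  obtain ⟨y, hy, hmem⟩ := exists_mem_stdSimplex_forall_mem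
    (fun i => {y | y ∈ stdSimplex ℝ I ∧ U y i ≤ p i})
    (fun i => by
      have h1 : ContinuousOn (fun y => U y i) (stdSimplex ℝ I) :=
        (continuous_apply i).comp_continuousOn hUc
      exact h1.preimage_isClosed_of_isClosed (isClosed_stdSimplex ℝ I) isClosed_Iic)
    (fun y hy => by
      by_contra! hcon
      have h1 : ∀ i, p i < U y i := fun i => by
        by_contra! h
        exact hcon i ⟨hy, h⟩
      have h2 : dotProduct p h < dotProduct (U y) h :=
        sum_lt_sum_of_nonempty univ_nonempty fun i _ => mul_lt_mul_of_pos_right (h1 i) (hh i)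
      rw [hUh y hy, ← hH] at h2
      exact lt_irrefl _ h2)
    (fun y hy i hyi => by
      refine ⟨hy, ?_⟩
      obtain ⟨ψ, hψ1, hψ2⟩ := hψ _ (hQpos y hy)
      refine (vecMul_inv_pow_le hh (hoff _ (hQpos y hy)) (hAh _ (hQpos y hy)) hC hψ1 hψ2 n i).trans
        ?_
      have h1 : Q y i = ε * p i := by simp [Q, hyi]
      rw [h1, ← mul_assoc]
      exact mul_le_of_le_one_left (hp i).le hCε)
  have hUp : U y = p := by
    funext i
    have h1 : ∀ i ∈ univ, U y i * h i ≤ p i * h i := fun i _ =>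
      mul_le_mul_of_nonneg_right (hmem i).2 (hh i).le
    have h2 := (sum_eq_sum_iff_of_le h1).1 (hUh y hy) i (mem_univ i)
    exact mul_right_cancel₀ (hh i).ne' h2
  refine ⟨Q y, hQpos y hy, ?_⟩
  have h1 := (Matrix.isUnit_iff_isUnit_det _).1 (hunit y hy)
  rw [← hUp, Matrix.vecMul_vecMul, Matrix.inv_pow', Matrix.nonsing_inv_mul, Matrix.vecMul_one]
  rw [Matrix.det_pow]
  exact h1.pow n

/-- Extension of a vector on `Fin M` to the indices `1, …, M`, by zero elsewhere. -/
def extendFin (M : ℕ) (q : Fin M → ℝ) (a : ℕ) : ℝ :=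
  if h : 1 ≤ a ∧ a ≤ M then q ⟨a - 1, by omega⟩ else 0

lemma extendFin_add_one {M : ℕ} (q : Fin M → ℝ) (u : Fin M) : extendFin M q (u.1 + 1) = q u := by
  rw [extendFin, dif_pos ⟨by omega, u.2⟩]
  rfl

lemma extendFin_pos {M : ℕ} {q : Fin M → ℝ} (hq : ∀ u, 0 < q u) (a : ℕ) (h1 : 1 ≤ a)
    (h2 : a ≤ M) : 0 < extendFin M q a := by
  rw [extendFin, dif_pos ⟨h1, h2⟩]
  exact hq _

lemma continuous_extendFin (M a : ℕ) : Continuous fun q => extendFin M q a := by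
  unfold extendFin
  split_ifs <;> fun_prop

lemma continuousOn_potIntensity {M : ℕ} {κ : ℕ → ℝ} (hκ : StrictMonoOn κ (Set.Icc 1 M))
    (kh : ℕ → ℝ) {s : ℝ} (hs : 0 < s) (j : ℕ) :
    ContinuousOn (fun q => potIntensity M s κ kh (extendFin M q) j) {q | ∀ u, 0 < q u} := by
  by_cases hj : 2 ≤ j ∧ j ≤ M - 1
  · refine (midPot_continuousOn M κ kh (fun q => extendFin M q)
      (fun a => (continuous_extendFin M a).continuousOn) j).div
      (continuous_const.mul (continuous_extendFin M j)).continuousOn fun q hq => ?_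
    exact (mul_pos (mul_pos hs (gridWidth_pos hκ hj.1 hj.2))
      (extendFin_pos hq j (by omega) (by omega))).ne'
  · simp_rw [potIntensity_eq_zero hj]
    exact continuousOn_const

lemma continuousOn_NtE {Y : Type*} [TopologicalSpace Y] {S : Set Y} (M : ℕ) (s : ℝ)
    (i b k : ℕ → ℝ) {lam : Y → ℕ → ℝ} (hlam : ∀ j, ContinuousOn (fun y => lam y j) S) (a c : ℕ) :
    ContinuousOn (fun y => NtE M s i b k (lam y) a c) S := by
  have := hlam a
  unfold NtE
  split_ifs <;> fun_prop

lemma NtE_nonpos {M : ℕ} {s : ℝ} (hs : 0 < s) {i b k κ lam : ℕ → ℝ}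
    (hκ : StrictMonoOn κ (Set.Icc 1 M)) (hm : MartCoord M i b κ)
    (hkt : ∀ j, 0 ≤ ktil M i k j) (hlam : ∀ j, 2 ≤ j → j ≤ M - 1 → 0 < lam j) {a c : ℕ}
    (hac : a ≠ c) : NtE M s i b k lam a c ≤ 0 := by
  unfold NtE
  split_ifs with h1 h2 h3 h4 h5 h6
  · exact absurd h2.symm hac
  · obtain ⟨h7, h8⟩ := grid_gaps hκ h1.1 h1.2
    have h9 : 0 < qup i b a := by
      rw [(hm.2 a h1.1 h1.2).1]
      exact div_pos h8 (by linarith)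
    have := hlam a h1.1 h1.2
    exact neg_nonpos.2 (by positivity)
  · obtain ⟨h7, h8⟩ := grid_gaps hκ h1.1 h1.2
    have h9 : 0 < qdn i b a := by
      rw [(hm.2 a h1.1 h1.2).2]
      exact div_pos h7 (by linarith)
    have := hlam a h1.1 h1.2
    exact neg_nonpos.2 (by positivity)
  · have := hlam a h1.1 h1.2
    have := hkt a
    exact neg_nonpos.2 (by positivity)
  · exact le_rfl
  · exact absurd h6.symm hac
  · exact le_rfl

lemma MartCoord.strictMonoOn {M : ℕ} {i b κ : ℕ → ℝ} (hm : MartCoord M i b κ) :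
    StrictMonoOn κ (Set.Icc 1 M) := by
  intro a ha c hc hac
  obtain ⟨ha1, -⟩ := ha
  obtain ⟨-, hcM⟩ := hc
  induction c, hac using Nat.le_induction with
  | base => exact hm.1 a ha1 (by omega)
  | succ c hac ih => exact (ih (by omega)).trans (hm.1 c (by omega) (by omega))

/-- fixed point theorem content. With `t' = t/r`, there are an intensity
vector `λ` which is strictly positive on `{2,…,M-1}` and an index `l ∈ {2,…,M}` such that
the push-forward `w = p·N_{t'}(λ)^{r-1}` has strictly positive entries and, with `q` its
normalization, `(λ, l)` solves the G-system with time parameter `t'` and probability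
vector `q` (this comprises the location of `x₀` and the fixed point equations (iii), (iv)). -/
theorem stmt_10 (M : ℕ) (hM : 3 ≤ M) (i b k κ p : ℕ → ℝ) (t : ℝ) (ht : 0 < t)
    (r : ℕ) (hr : 1 ≤ r)
    (hi : ∀ j, 1 ≤ j → j ≤ M - 1 → i j < i (j + 1))
    (hb : DriftHyp M i b)
    (hk : ∀ j, 2 ≤ j → j ≤ M - 1 → 0 ≤ k j)
    (hκ : MartCoord M i b κ)
    (hp : ProbVec M p) :
    ∃ lam : ℕ → ℝ, ∃ l : ℕ,
      (∀ j, 2 ≤ j → j ≤ M - 1 → 0 < lam j) ∧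
      (∀ j, ¬(2 ≤ j ∧ j ≤ M - 1) → lam j = 0) ∧
      2 ≤ l ∧ l ≤ M ∧
      (∀ v : Fin M, 0 < wvec M r (t / r) i b k lam p v) ∧
      GSystem M (t / r) κ (ktil M i k)
        (qnorm M r (by omega) (t / r) i b k lam p) lam l := by
  have hκm := hκ.strictMonoOn
  have hs : 0 < t / r := div_pos ht (by exact_mod_cast hr)
  set s := t / r
  have hkt : ∀ j, 0 ≤ ktil M i k j := by
    intro j
    unfold ktil
    split_ifs with h
    · have h1 := hi j (by omega) h.2
      have h2 := hi (j - 1) (by omega) (by omega)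
      rw [Nat.sub_add_cancel (by omega)] at h2
      exact mul_nonneg (mul_nonneg (by linarith) (by linarith)) (hk j h.1 h.2)
    · exact le_rfl
  set kh : ℕ → ℝ := fun a => ktil M i k a / gridWidth κ a with hkhdef
  have hkhk : ∀ a, kh a = ktil M i k a / gridWidth κ a := fun _ => rfl
  have hkh : ∀ a, 0 ≤ kh a := by
    intro a
    by_cases h : 2 ≤ a ∧ a ≤ M - 1
    · exact div_nonneg (hkt a) (gridWidth_pos hκm h.1 h.2).le
    · simp only [hkhdef, ktil]
      rw [if_neg h, zero_div]
  obtain ⟨h, hhpos, hharm⟩ := exists_pos_harmonic hκm hκ hkh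
  obtain ⟨C, hC, hsup⟩ := exists_pos_supersolution hM hκm hkh
  have : Nontrivial (Fin M) := Fin.nontrivial_iff_two_le.2 (by omega)
  set lam : (Fin M → ℝ) → ℕ → ℝ := fun q => potIntensity M s κ kh (extendFin M q)
  have hlampos : ∀ q : Fin M → ℝ, (∀ u, 0 < q u) → ∀ j, 2 ≤ j → j ≤ M - 1 → 0 < lam q j :=
    fun q hq j h2 hj => potIntensity_pos hκm hkh (extendFin_pos hq) hs h2 hj
  have hlam0 : ∀ q : Fin M → ℝ, ∀ j, ¬(2 ≤ j ∧ j ≤ M - 1) → lam q j = 0 := fun q j hj =>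
    potIntensity_eq_zero hj s κ kh _
  obtain ⟨q, hq, hqeq⟩ := exists_pos_vecMul_pow_eq
    (fun q => NMat M s i b k (lam q)) (h := fun u => h (u.1 + 1)) (p := fun u => p (u.1 + 1))
    (fun u => hhpos _ (by omega) u.2) (fun u => hp.1 _ (by omega) u.2)
    (fun u v => continuousOn_NtE M s i b k
      (fun j => continuousOn_potIntensity hκm kh hs j) (u.1 + 1) (v.1 + 1))
    (fun q hq u v huv => NtE_nonpos hs hκm hκ hkt (hlampos q hq)
      fun h => huv (Fin.ext (by omega)))
    (fun q hq => by
      funext u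
      have h1 := sum_NtE_mul_row (s := s) (i := i) (b := b) (k := k) (hlam0 q) h
        (a := u.1 + 1) (by omega) u.2
      rw [← sum_fin_add_one_eq_sum_Icc
        (fun c => NtE M s i b k (lam q) (u.1 + 1) c * h c)] at h1
      refine h1.trans ?_
      by_cases hj : 2 ≤ u.1 + 1 ∧ u.1 + 1 ≤ M - 1
      · rw [hharm _ hj.1 hj.2, mul_zero, add_zero]
      · rw [hlam0 q _ hj]
        simp)
    hC.le
    (fun q hq => by
      obtain ⟨τ, hτ⟩ := hsup (extendFin M q) (extendFin_pos hq)
      refine ⟨fun u => τ (u.1 + 1) * extendFin M q (u.1 + 1), fun u => ?_, fun u => ?_⟩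
      · simp only [extendFin_add_one]
        exact mul_le_mul_of_nonneg_right (hτ _ (by omega) u.2).2.1 (hq u).le
      · have h1 := sum_mul_NtE_eq_potStep hs hκm hκ hkhk (extendFin_pos hq) τ
          (c := u.1 + 1) (by omega) u.2
        rw [← sum_fin_add_one_eq_sum_Icc (fun a => τ a * extendFin M q a *
          NtE M s i b k (potIntensity M s κ kh (extendFin M q)) a (u.1 + 1))] at h1
        have h2 := (hτ (u.1 + 1) (by omega) u.2).2.2
        rw [extendFin_add_one, ← h1] at h2
        exact h2)
    (r - 1)
  have hw : wvec M r s i b k (lam q) p = q := hqeq.symm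
  have hW : 0 < ∑ v : Fin M, q v := sum_pos (fun v _ => hq v) univ_nonempty
  obtain ⟨l, hl⟩ := exists_GSystem_potIntensity hM hκm hkh hkhk (extendFin_pos hq) hs hW
    (P := qnorm M r (by omega) s i b k (lam q) p) (fun a h1 h2 => by
      rw [qnorm, hw, extendFin, dif_pos ⟨h1, h2⟩]
      congr 3
      exact Nat.mod_eq_of_lt (by omega))
  refine ⟨lam q, l, hlampos q hq, hlam0 q, hl.1, hl.2.1, fun v => ?_, hl⟩
  rw [hw]
  exact hq v
end
end

section
/- Let t > 0, r ≥ 1 an integer, ε ∈ (0,1), reals κ₁ < ⋯ < κ_M, and nonnegative k̃₁,…,k̃_M with k̃₁ = k̃_M = 0. Set a = (1/ε)·max_{2≤j≤M−1} [r(κ_{j+1}−κ_{j−1})(κ_M−κ₁)] / [t(κ_{j+1}−κ_j)(κ_j−κ_{j−1})] and b = a·t·max_{2≤j≤M−1} k̃_j. Then for every probability vector P ∈ 𝕊^M with P_j ≥ ε for every j, every solution (G, l) of the G-system with time parameter t/r and probability vector P satisfies max_{1≤j≤M} G_j ≤ a(1+b)^{M−2}. -/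
noncomputable section

open Finset

/-- Discrete Grönwall inequality: if `x (n + 1)` is at most `A` times any common upper bound of
`1 + x m * v m` over `m ≤ n`, then `x` grows at most geometrically. -/
lemma le_geometric_of_step {x v : ℕ → ℝ} {A K : ℝ} {N : ℕ} (hA : 0 ≤ A) (hK : 0 ≤ K)
    (hx0 : x 0 = 0) (hx : ∀ n ≤ N, 0 ≤ x n) (hv : ∀ n ≤ N, v n ≤ K)
    (hstep : ∀ n < N, ∀ C : ℝ, (∀ m ≤ n, 1 + x m * v m ≤ C) → x (n + 1) ≤ A * C) :
    ∀ n ≤ N, x n ≤ A * (1 + A * K) ^ N := by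
  have hb : 1 ≤ 1 + A * K := by nlinarith [mul_nonneg hA hK]
  have key : ∀ n ≤ N, 1 + x n * v n ≤ (1 + A * K) ^ n ∧ x n ≤ A * (1 + A * K) ^ n := by
    intro n
    induction n using Nat.strong_induction_on with
    | _ n ih =>
      intro hn
      rcases n with _ | n
      · simp [hx0, hA]
      · have hle : x (n + 1) ≤ A * (1 + A * K) ^ n :=
          hstep n (by omega) _ fun m hm =>
            (ih m (by omega) (by omega)).1.trans (pow_le_pow_right₀ hb hm)
        have hone : 1 ≤ (1 + A * K) ^ n := one_le_pow₀ hb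
        constructor
        · calc 1 + x (n + 1) * v (n + 1)
              ≤ (1 + A * K) ^ n + A * (1 + A * K) ^ n * K := by
                have h1 := mul_le_mul_of_nonneg_left (hv _ hn) (hx _ hn)
                have h2 := mul_le_mul_of_nonneg_right hle hK
                linarith
            _ = (1 + A * K) ^ (n + 1) := by ring
        · exact hle.trans
            (mul_le_mul_of_nonneg_left (pow_le_pow_right₀ hb n.le_succ) hA)
  exact fun n hn => (key n hn).2.trans
    (mul_le_mul_of_nonneg_left (pow_le_pow_right₀ hb hn) hA)

lemma ProbVec.sum_mul_le {M : ℕ} {P : ℕ → ℝ} (hP : ProbVec M P) {S : Finset ℕ}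
    (hS : S ⊆ Finset.Icc 1 M) {w u : ℕ → ℝ} {D C : ℝ} (hD : 0 ≤ D) (hC : 0 ≤ C)
    (hw : ∀ a ∈ S, 0 ≤ w a ∧ w a ≤ D) (hu : ∀ a ∈ S, u a ≤ C) :
    ∑ a ∈ S, w a * P a * u a ≤ D * C := by
  have hpos : ∀ a ∈ Finset.Icc 1 M, 0 ≤ P a := fun a ha =>
    (hP.1 a (Finset.mem_Icc.1 ha).1 (Finset.mem_Icc.1 ha).2).le
  calc ∑ a ∈ S, w a * P a * u a ≤ ∑ a ∈ S, P a * (D * C) := by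
        refine Finset.sum_le_sum fun a ha => ?_
        have hPa := hpos a (hS ha)
        calc w a * P a * u a ≤ w a * P a * C :=
              mul_le_mul_of_nonneg_left (hu a ha) (mul_nonneg (hw a ha).1 hPa)
          _ ≤ D * P a * C := by gcongr; exact (hw a ha).2
          _ = P a * (D * C) := by ring
    _ = (∑ a ∈ S, P a) * (D * C) := by rw [Finset.sum_mul]
    _ ≤ 1 * (D * C) := by
        refine mul_le_mul_of_nonneg_right ?_ (mul_nonneg hD hC)
        rw [← hP.2]
        exact Finset.sum_le_sum_of_subset_of_nonneg hS fun a ha _ => hpos a ha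
    _ = D * C := one_mul _

lemma le_of_step_lt {M : ℕ} {κ : ℕ → ℝ} (hκ : ∀ j, 1 ≤ j → j ≤ M - 1 → κ j < κ (j + 1))
    {i j : ℕ} (hi : 1 ≤ i) (hij : i ≤ j) (hj : j ≤ M) : κ i ≤ κ j := by
  induction j, hij using Nat.le_induction with
  | base => exact le_rfl
  | succ n hn ih => exact (ih (by omega)).trans (hκ n (by omega) (by omega)).le

/-- a priori bound on G-system solutions. With
`a = (1/ε)·max_{2≤j≤M-1} r(κ_{j+1}-κ_{j-1})(κ_M-κ₁)/(t(κ_{j+1}-κ_j)(κ_j-κ_{j-1}))` and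
`b = a·t·max_{2≤j≤M-1} k̃_j`, every solution `(G,l)` of the G-system with time parameter
`t/r` and probability vector `P` satisfying `P_j ≥ ε` for all `j` obeys
`max_j G_j ≤ a(1+b)^{M-2}`. -/
theorem stmt_11 (M : ℕ) (hM : 3 ≤ M) (t : ℝ) (ht : 0 < t) (r : ℕ) (hr : 1 ≤ r)
    (ε : ℝ) (hε0 : 0 < ε) (hε1 : ε < 1) (κ kt : ℕ → ℝ)
    (hκ : ∀ j, 1 ≤ j → j ≤ M - 1 → κ j < κ (j + 1))
    (hkt : ∀ j, 1 ≤ j → j ≤ M → 0 ≤ kt j) (hkt1 : kt 1 = 0) (hktM : kt M = 0) :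
    ∀ P : ℕ → ℝ, ProbVec M P → (∀ j, 1 ≤ j → j ≤ M → ε ≤ P j) →
      ∀ G : ℕ → ℝ, ∀ l : ℕ, GSystem M (t / r) κ kt P G l →
        ∀ j, 1 ≤ j → j ≤ M →
          G j ≤
            ((1 / ε) * (Finset.Icc 2 (M - 1)).sup'
                (Finset.nonempty_Icc.mpr (by omega))
                (fun m => (r * (κ (m + 1) - κ (m - 1)) * (κ M - κ 1)) /
                  (t * (κ (m + 1) - κ m) * (κ m - κ (m - 1))))) *
              (1 + ((1 / ε) * (Finset.Icc 2 (M - 1)).sup'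
                  (Finset.nonempty_Icc.mpr (by omega))
                  (fun m => (r * (κ (m + 1) - κ (m - 1)) * (κ M - κ 1)) /
                    (t * (κ (m + 1) - κ m) * (κ m - κ (m - 1))))) * t *
                (Finset.Icc 2 (M - 1)).sup'
                  (Finset.nonempty_Icc.mpr (by omega)) (fun m => kt m)) ^ (M - 2) := by
  rintro P hP hPε G l ⟨hl2, hlM, hG0, hG1, hGM, -, -, hleft, hright⟩ j hj1 hjM
  set X := (Finset.Icc 2 (M - 1)).sup' (Finset.nonempty_Icc.mpr (by omega))
    (fun m => (r * (κ (m + 1) - κ (m - 1)) * (κ M - κ 1)) /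
      (t * (κ (m + 1) - κ m) * (κ m - κ (m - 1))))
  set Y := (Finset.Icc 2 (M - 1)).sup' (Finset.nonempty_Icc.mpr (by omega))
    (fun m => kt m)
  have hr0 : (1 : ℝ) ≤ r := by exact_mod_cast hr
  have hmono : ∀ {i k : ℕ}, 1 ≤ i → i ≤ k → k ≤ M → κ i ≤ κ k := le_of_step_lt hκ
  have hD : 0 ≤ κ M - κ 1 := sub_nonneg.2 (hmono le_rfl (by omega) le_rfl)
  have hgap : ∀ m, 2 ≤ m → m ≤ M - 1 → 0 < κ (m + 1) - κ m ∧ 0 < κ m - κ (m - 1) ∧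
      0 < κ (m + 1) - κ (m - 1) := by
    intro m h2 hm
    have h1 := hκ m (by omega) hm
    have h3 := hκ (m - 1) (by omega) (by omega)
    rw [Nat.sub_add_cancel (by omega)] at h3
    exact ⟨by linarith, by linarith, by linarith⟩
  have hXle : ∀ m, 2 ≤ m → m ≤ M - 1 → (r * (κ (m + 1) - κ (m - 1)) * (κ M - κ 1)) /
      (t * (κ (m + 1) - κ m) * (κ m - κ (m - 1))) ≤ X := fun m h2 hm =>
    Finset.le_sup' (fun m => (r * (κ (m + 1) - κ (m - 1)) * (κ M - κ 1)) /
      (t * (κ (m + 1) - κ m) * (κ m - κ (m - 1)))) (Finset.mem_Icc.2 ⟨h2, hm⟩)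
  have hYle : ∀ m, 2 ≤ m → m ≤ M - 1 → kt m ≤ Y := fun m h2 hm =>
    Finset.le_sup' (fun m => kt m) (Finset.mem_Icc.2 ⟨h2, hm⟩)
  have hX0 : 0 ≤ X := by
    refine le_trans ?_ (hXle 2 le_rfl (by omega))
    obtain ⟨h1, h2, h3⟩ := hgap 2 le_rfl (by omega)
    positivity
  have hY0 : 0 ≤ Y := (hkt 2 (by omega) (by omega)).trans (hYle 2 le_rfl (by omega))
  have hA : 0 ≤ 1 / ε * X := by positivity
  have hK : 0 ≤ t * Y := by positivity
  have hv : ∀ m, 1 ≤ m → m ≤ M → t / r * kt m ≤ t * Y := by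
    intro m h1 hm
    have hktY : kt m ≤ Y := by
      rcases eq_or_ne m 1 with rfl | hm1
      · rwa [hkt1]
      rcases eq_or_ne m M with rfl | hmM
      · rwa [hktM]
      exact hYle m (by omega) (by omega)
    exact mul_le_mul (div_le_self ht.le hr0) hktY (hkt m h1 hm) ht.le
  have hbound : ∀ m, 2 ≤ m → m ≤ M - 1 → ∀ S ⊆ Finset.Icc 1 M, ∀ (w : ℕ → ℝ) (C : ℝ), 0 ≤ C →
      (∀ a ∈ S, 0 ≤ w a ∧ w a ≤ κ M - κ 1) → (∀ a ∈ S, 1 + t / r * G a * kt a ≤ C) →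
      (1 / (t / r * P m)) *
        ((κ (m + 1) - κ (m - 1)) / ((κ (m + 1) - κ m) * (κ m - κ (m - 1)))) *
        ∑ a ∈ S, w a * P a * (1 + t / r * G a * kt a) ≤ 1 / ε * X * C := by
    intro m h2 hm S hS w C hC hw hu
    obtain ⟨h3, h4, h5⟩ := hgap m h2 hm
    have hPm := hP.1 m (by omega) (by omega)
    calc _ ≤ (1 / (t / r * P m)) *
          ((κ (m + 1) - κ (m - 1)) / ((κ (m + 1) - κ m) * (κ m - κ (m - 1)))) *
          ((κ M - κ 1) * C) :=
          mul_le_mul_of_nonneg_left (hP.sum_mul_le hS hD hC hw hu) (by positivity)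
      _ = 1 / P m * ((r * (κ (m + 1) - κ (m - 1)) * (κ M - κ 1)) /
          (t * (κ (m + 1) - κ m) * (κ m - κ (m - 1)))) * C := by
          field_simp
      _ ≤ 1 / ε * X * C := by
          refine mul_le_mul_of_nonneg_right ?_ hC
          exact mul_le_mul (one_div_le_one_div_of_le hε0 (hPε m (by omega) (by omega)))
            (hXle m h2 hm) (by positivity) (by positivity)
  have hpow : ∀ N ≤ M - 2,
      1 / ε * X * (1 + 1 / ε * X * (t * Y)) ^ N ≤
        1 / ε * X * (1 + 1 / ε * X * t * Y) ^ (M - 2) := by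
    intro N hN
    rw [← mul_assoc (1 / ε * X) t Y]
    exact mul_le_mul_of_nonneg_left
      (pow_le_pow_right₀ (le_add_of_nonneg_right (by positivity)) hN) hA
  rcases Nat.lt_or_ge j l with hjl | hjl
  · refine le_trans ?_ (hpow (l - 2) (by omega))
    have h := le_geometric_of_step (x := fun n => G (n + 1)) (v := fun n => t / r * kt (n + 1))
      (N := l - 2) hA hK hG1 (fun n hn => hG0 _ (by omega) (by omega))
      (fun n hn => hv _ (by omega) (by omega)) ?_ (j - 1) (by omega)
    · simpa [Nat.sub_add_cancel hj1] using h
    · intro n hn C hC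
      have hC0 : 0 ≤ C := by
        have := hC 0 (Nat.zero_le _)
        simp only [zero_add, hG1, zero_mul, add_zero] at this
        linarith
      change G (n + 1 + 1) ≤ _
      rw [hleft (n + 1 + 1) (by omega) (by omega)]
      refine hbound (n + 1 + 1) (by omega) (by omega) _
        (Finset.Icc_subset_Icc_right (by omega)) (fun a => κ (n + 1 + 1) - κ a) C hC0 ?_ ?_
      · intro a ha
        rw [Finset.mem_Icc] at ha
        have h1 := hmono ha.1 (show a ≤ n + 1 + 1 by omega) (by omega)
        have h2 := hmono (show 1 ≤ n + 1 + 1 by omega) (show n + 1 + 1 ≤ M by omega) le_rfl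
        have h3 := hmono le_rfl ha.1 (by omega)
        exact ⟨by linarith, by linarith⟩
      · intro a ha
        rw [Finset.mem_Icc] at ha
        have := hC (a - 1) (by omega)
        simp only [Nat.sub_add_cancel ha.1] at this
        linarith
  · refine le_trans ?_ (hpow (M - l) (by omega))
    have h := le_geometric_of_step (x := fun n => G (M - n)) (v := fun n => t / r * kt (M - n))
      (N := M - l) hA hK hGM (fun n hn => hG0 _ (by omega) (by omega))
      (fun n hn => hv _ (by omega) (by omega)) ?_ (M - j) (by omega)
    · simpa [Nat.sub_sub_self hjM] using h
    · intro n hn C hC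
      have hC0 : 0 ≤ C := by
        have := hC 0 (Nat.zero_le _)
        simp only [Nat.sub_zero, hGM, zero_mul, add_zero] at this
        linarith
      change G (M - (n + 1)) ≤ _
      rw [hright (M - (n + 1)) (by omega) (by omega)]
      refine hbound (M - (n + 1)) (by omega) (by omega) _
        (Finset.Icc_subset_Icc_left (by omega)) (fun a => κ a - κ (M - (n + 1))) C hC0 ?_ ?_
      · intro a ha
        rw [Finset.mem_Icc] at ha
        have h1 := hmono (show 1 ≤ M - (n + 1) by omega) (show M - (n + 1) ≤ a by omega) ha.2
        have h2 := hmono le_rfl (show 1 ≤ M - (n + 1) by omega) (by omega)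
        have h3 := hmono (show 1 ≤ a by omega) ha.2 le_rfl
        exact ⟨by linarith, by linarith⟩
      · intro a ha
        rw [Finset.mem_Icc] at ha
        have := hC (M - a) (by omega)
        simp only [Nat.sub_sub_self ha.2] at this
        linarith
end
end

section
/- Let M ≥ 3, reals i₁ < ⋯ < i_M, δ_j = i_j − i_{j−1} for j = 2,…,M, and a drift vector b = (b₂,…,b_{M−1}) satisfying the drift hypothesis, extended by b₁ = 0. Fix indices 1 ≤ e₋ < e₊ ≤ M and K > 0, and define ε_{j+1} = K·δ_{j+1}·∏_{k=2}^{j}((1−δ_k b_k)/(1+δ_{k+1} b_k)) / (∑_{a=e₋}^{e₊−1} δ_{a+1}·∏_{k=2}^{a}((1−δ_k b_k)/(1+δ_{k+1} b_k))) for j = 1,…,M−1 (empty products equal 1). Fix any index e ∈ {1,…,M}, set κ_e = 0 and define κ recursively by κ_j − κ_{j−1} = ε_j for j = 2,…,M. Then: (i) ε_j > 0 for every j, so κ₁ < κ₂ < ⋯ < κ_M; (ii) ε_{j+1}/ε_j = (δ_{j+1}/δ_j)·(1−δ_j b_j)/(1+δ_{j+1} b_j) for j = 2,…,M−1; (iii)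 κ_{e₊} − κ_{e₋} = K; and (iv) for j = 2,…,M−1, q_{j,j+1} = (κ_j−κ_{j−1})/(κ_{j+1}−κ_{j−1}) and q_{j,j−1} = (κ_{j+1}−κ_j)/(κ_{j+1}−κ_{j−1}), i.e. κ are martingale coordinates for (i,b). -/
noncomputable section

open Finset MeasureTheory

theorem one_add_mul_pos {x y : ℝ} (hx : 0 < x) (h : -(1 / x) < y) : 0 < 1 + x * y := by
  have := mul_lt_mul_of_pos_left h hx
  rw [mul_neg, mul_one_div_cancel hx.ne'] at this
  linarith

theorem one_sub_mul_pos {x y : ℝ} (hx : 0 < x) (h : y < 1 / x) : 0 < 1 - x * y := by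
  have := mul_lt_mul_of_pos_left h hx
  rw [mul_one_div_cancel hx.ne'] at this
  linarith

/-- coordinate change. With `δ_j = i_j - i_{j-1}` and the explicit
increments `ε_{j+1} = K δ_{j+1} ∏_{k=2}^{j} (1-δ_k b_k)/(1+δ_{k+1} b_k) / D`, where `D` is
the normalizing sum over `a ∈ {e₋,…,e₊-1}`, the cumulative sums `κ` (anchored at
`κ_e = 0`) are strictly increasing, satisfy the ratio identity, `κ_{e₊} - κ_{e₋} = K`,
and are martingale coordinates for `(i,b)`. -/
theorem stmt_13 (M : ℕ) (hM : 3 ≤ M) (i b : ℕ → ℝ)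
    (hi : ∀ j, 1 ≤ j → j ≤ M - 1 → i j < i (j + 1))
    (hb : DriftHyp M i b) (hb1 : b 1 = 0)
    (em ep : ℕ) (hem : 1 ≤ em) (hemep : em < ep) (hep : ep ≤ M)
    (K : ℝ) (hK : 0 < K)
    (ε : ℕ → ℝ)
    (hε : ∀ j, 1 ≤ j → j ≤ M - 1 →
      ε (j + 1) =
        K * (i (j + 1) - i j) *
          (∏ m ∈ Finset.Icc 2 j,
            ((1 - (i m - i (m - 1)) * b m) / (1 + (i (m + 1) - i m) * b m))) /
          ∑ a ∈ Finset.Icc em (ep - 1),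
            (i (a + 1) - i a) *
              ∏ m ∈ Finset.Icc 2 a,
                ((1 - (i m - i (m - 1)) * b m) / (1 + (i (m + 1) - i m) * b m)))
    (e : ℕ) (he1 : 1 ≤ e) (heM : e ≤ M)
    (κ : ℕ → ℝ) (hκe : κ e = 0)
    (hκε : ∀ j, 2 ≤ j → j ≤ M → κ j - κ (j - 1) = ε j) :
    (∀ j, 2 ≤ j → j ≤ M → 0 < ε j) ∧
    (∀ j, 1 ≤ j → j ≤ M - 1 → κ j < κ (j + 1)) ∧
    (∀ j, 2 ≤ j → j ≤ M - 1 →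
      ε (j + 1) / ε j =
        ((i (j + 1) - i j) / (i j - i (j - 1))) *
          ((1 - (i j - i (j - 1)) * b j) / (1 + (i (j + 1) - i j) * b j))) ∧
    (κ ep - κ em = K) ∧
    MartCoord M i b κ := by
  have hd : ∀ j, 2 ≤ j → j ≤ M → 0 < i j - i (j - 1) := by
    intro j h2 hj
    have h := hi (j - 1) (by omega) (by omega)
    rw [Nat.sub_add_cancel (by omega : 1 ≤ j)] at h
    exact sub_pos.2 h
  have hd' : ∀ j, 1 ≤ j → j ≤ M - 1 → 0 < i (j + 1) - i j := fun j h1 hj =>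
    sub_pos.2 (hi j h1 hj)
  have hup : ∀ j, 2 ≤ j → j ≤ M - 1 → 0 < 1 + (i (j + 1) - i j) * b j := fun j h2 hj =>
    one_add_mul_pos (hd' j (by omega) hj) (hb j h2 hj).1
  have hdn : ∀ j, 2 ≤ j → j ≤ M - 1 → 0 < 1 - (i j - i (j - 1)) * b j := fun j h2 hj =>
    one_sub_mul_pos (hd j h2 (by omega)) (hb j h2 hj).2
  set r : ℕ → ℝ := fun m =>
    (1 - (i m - i (m - 1)) * b m) / (1 + (i (m + 1) - i m) * b m) with hr
  have hp : ∀ j, j ≤ M - 1 → 0 < ∏ m ∈ Finset.Icc 2 j, r m := fun j hj =>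
    Finset.prod_pos fun m hm => by
      rw [Finset.mem_Icc] at hm
      exact div_pos (hdn m hm.1 (by omega)) (hup m hm.1 (by omega))
  set D : ℝ := ∑ a ∈ Finset.Icc em (ep - 1),
    (i (a + 1) - i a) * ∏ m ∈ Finset.Icc 2 a, r m with hD
  have hD0 : 0 < D := Finset.sum_pos
    (fun a ha => by
      rw [Finset.mem_Icc] at ha
      exact mul_pos (hd' a (by omega) (by omega)) (hp a (by omega)))
    (Finset.nonempty_Icc.2 (by omega))
  have hε' : ∀ j, 1 ≤ j → j ≤ M - 1 → 0 < ε (j + 1) := fun j h1 hj => by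
    rw [hε j h1 hj]
    exact div_pos (mul_pos (mul_pos hK (hd' j h1 hj)) (hp j hj)) hD0
  have hεpos : ∀ j, 2 ≤ j → j ≤ M → 0 < ε j := fun j h2 hj => by
    have h := hε' (j - 1) (by omega) (by omega)
    rwa [Nat.sub_add_cancel (by omega : 1 ≤ j)] at h
  have hκs : ∀ j, 1 ≤ j → j ≤ M - 1 → κ (j + 1) - κ j = ε (j + 1) := fun j h1 hj =>
    hκε (j + 1) (by omega) (by omega)
  have hmono : ∀ j, 1 ≤ j → j ≤ M - 1 → κ j < κ (j + 1) := fun j h1 hj =>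
    sub_pos.1 (hκs j h1 hj ▸ hε' j h1 hj)
  have hrec : ∀ j, 2 ≤ j → j ≤ M - 1 →
      ε (j + 1) = ε j * ((i (j + 1) - i j) / (i j - i (j - 1)) * r j) := by
    intro j h2 hj
    clear_value r
    obtain ⟨n, rfl⟩ : ∃ n, j = n + 1 := ⟨j - 1, by omega⟩
    have hδ := (hd (n + 1) h2 (by omega)).ne'
    rw [hε (n + 1) (by omega) hj, hε n (by omega) (by omega),
      Finset.prod_Icc_succ_top (by omega : 2 ≤ n + 1)]
    rw [Nat.add_sub_cancel] at hδ ⊢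
    field_simp
  have hratio : ∀ j, 2 ≤ j → j ≤ M - 1 →
      ε (j + 1) / ε j = (i (j + 1) - i j) / (i j - i (j - 1)) * r j := fun j h2 hj => by
    rw [hrec j h2 hj, mul_div_cancel_left₀ _ (hεpos j h2 (by omega)).ne']
  refine ⟨hεpos, hmono, hratio, ?_, hmono, fun j h2 hj => ?_⟩
  · have hsum : κ ep - κ em = ∑ a ∈ Finset.Ico em ep, ε (a + 1) := by
      rw [← Finset.sum_Ico_sub κ hemep.le]
      refine Finset.sum_congr rfl fun a ha => ?_
      rw [Finset.mem_Ico] at ha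
      exact hκs a (by omega) (by omega)
    have hIco : Finset.Ico em ep = Finset.Icc em (ep - 1) := by
      ext a
      simp only [Finset.mem_Ico, Finset.mem_Icc]
      omega
    have hterm : ∀ a ∈ Finset.Icc em (ep - 1),
        ε (a + 1) = K / D * ((i (a + 1) - i a) * ∏ m ∈ Finset.Icc 2 a, r m) := by
      intro a ha
      rw [Finset.mem_Icc] at ha
      rw [hε a (by omega) (by omega)]
      ring
    rw [hsum, hIco, Finset.sum_congr rfl hterm, ← Finset.mul_sum, ← hD,
      div_mul_cancel₀ _ hD0.ne']
  · have h1 := hκs j (by omega) hj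
    have h0 := hκε j h2 (by omega)
    have hδ := hd j h2 (by omega)
    have hδ' := hd' j (by omega) hj
    have hu := hup j h2 hj
    have h := hrec j h2 hj
    have he0 := hεpos j h2 (by omega)
    have he1 := hε' j (by omega) hj
    have hcross : ε (j + 1) * ((i j - i (j - 1)) * (1 + (i (j + 1) - i j) * b j)) =
        ε j * ((i (j + 1) - i j) * (1 - (i j - i (j - 1)) * b j)) := by
      rw [h, hr]
      field_simp
    have hκ2 : κ (j + 1) - κ (j - 1) = ε (j + 1) + ε j := by rw [← h1, ← h0]; ring
    have hi2 : (0 : ℝ) < i (j + 1) - i (j - 1) := by linarith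
    rw [h1, h0, hκ2, qup, qdn, div_mul_eq_mul_div, div_mul_eq_mul_div,
      div_eq_div_iff hi2.ne' (by positivity), div_eq_div_iff hi2.ne' (by positivity)]
    constructor
    · linear_combination hcross
    · linear_combination -hcross
end
end
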